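/- arXiv:2001.00900 — 8 statements merged into one kernel-verified Lean document; each statement's English description precedes it below -/
import Mathlib

section
/- Let λ > 0, let β, η, c : [0,∞) → ℝ be bounded, nonnegative and continuous, and let g : ℝ³ → ℝ be continuous. Let x₁, z₂, x̄₁, z̄₂ : [0,∞) → ℝ be bounded functions with |x₁(t) − x̄₁(t)| → 0 and |z₂(t) − z̄₂(t)| → 0 as t → ∞. Then liminf_{t→∞} ∫_t^{t+λ} [β(s)x₁(s) − η(s)g(x₁(s),0,z₂(s)) − c(s)] ds = liminf_{t→∞} ∫_t^{t+λ} [β(s)x̄₁(s) − η(s)g(x̄₁(s),0,z̄₂(s)) − c(s)] ds, and the same equality holds with limsup in place of liminf. In particular, the thresholds ℛ^ℓ(λ) and ℛ^u(λ) are independent of the particular solutions used to define them. -/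
open Filter MeasureTheory Set

theorem aux_limsup_le (u v : ℝ → ℝ) (B : ℝ) (hu : ∀ᶠ t in atTop, |u t| ≤ B)
    (hv : ∀ᶠ t in atTop, |v t| ≤ B)
    (h : Tendsto (fun t => u t - v t) atTop (nhds 0)) :
    limsup u atTop ≤ limsup v atTop := by
  have hub : IsCoboundedUnder (· ≤ ·) atTop u :=
    IsBoundedUnder.isCoboundedUnder_le ⟨-B, by
      rw [eventually_map]; filter_upwards [hu] with t ht using (abs_le.1 ht).1⟩
  have hvb : IsBoundedUnder (· ≤ ·) atTop v :=
    ⟨B, by rw [eventually_map]; filter_upwards [hv] with t ht using (abs_le.1 ht).2⟩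
  refine le_of_forall_pos_le_add fun e he => ?_
  refine limsup_le_of_le hub ?_
  have h1 : ∀ᶠ t in atTop, v t < limsup v atTop + e / 2 :=
    eventually_lt_of_limsup_lt (by linarith) hvb
  have h2 : ∀ᶠ t in atTop, u t - v t < e / 2 := h.eventually_lt_const (by linarith)
  filter_upwards [h1, h2] with t a b
  linarith

theorem aux_le_liminf (u v : ℝ → ℝ) (B : ℝ) (hu : ∀ᶠ t in atTop, |u t| ≤ B)
    (hv : ∀ᶠ t in atTop, |v t| ≤ B)
    (h : Tendsto (fun t => u t - v t) atTop (nhds 0)) :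
    liminf v atTop ≤ liminf u atTop := by
  have hub : IsCoboundedUnder (· ≥ ·) atTop u :=
    IsBoundedUnder.isCoboundedUnder_ge ⟨B, by
      rw [eventually_map]; filter_upwards [hu] with t ht using (abs_le.1 ht).2⟩
  have hvb : IsBoundedUnder (· ≥ ·) atTop v :=
    ⟨-B, by rw [eventually_map]; filter_upwards [hv] with t ht using (abs_le.1 ht).1⟩
  refine le_of_forall_pos_le_add fun e he => ?_
  rw [← sub_le_iff_le_add]
  refine le_liminf_of_le hub ?_
  have h1 : ∀ᶠ t in atTop, liminf v atTop - e / 2 < v t :=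
    eventually_lt_of_lt_liminf (by linarith) hvb
  have h2 : ∀ᶠ t in atTop, -(e / 2) < u t - v t := h.eventually_const_lt (by linarith)
  filter_upwards [h1, h2] with t a b
  linarith

theorem aux_int_bound (lam : ℝ) (hlam : 0 < lam) (F : ℝ → ℝ) (B T : ℝ)
    (hF : ∀ t ≥ T, |F t| ≤ B) (t : ℝ) (ht : T ≤ t) :
    |∫ s in t..(t + lam), F s| ≤ B * lam := by
  have := intervalIntegral.norm_integral_le_of_norm_le_const (a := t) (b := t + lam) (f := F)
    (C := B) (fun s hs => by
      rw [uIoc_of_le (by linarith)] at hs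
      exact hF s (by linarith [hs.1]))
  simpa [abs_of_pos hlam] using this

theorem aux_main (lam : ℝ) (hlam : 0 < lam) (F G : ℝ → ℝ)
    (hF : ContinuousOn F (Ici 0)) (hG : ContinuousOn G (Ici 0))
    (hFb : ∃ M, ∀ t ≥ (0:ℝ), |F t| ≤ M) (hGb : ∃ M, ∀ t ≥ (0:ℝ), |G t| ≤ M)
    (h : Tendsto (fun t => F t - G t) atTop (nhds 0)) :
    liminf (fun t => ∫ s in t..(t + lam), F s) atTop
      = liminf (fun t => ∫ s in t..(t + lam), G s) atTop
    ∧ limsup (fun t => ∫ s in t..(t + lam), F s) atTop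
      = limsup (fun t => ∫ s in t..(t + lam), G s) atTop := by
  obtain ⟨M, hM⟩ := hFb
  obtain ⟨N, hN⟩ := hGb
  have hu : ∀ᶠ t in atTop, |∫ s in t..(t + lam), F s| ≤ max M N * lam := by
    filter_upwards [eventually_ge_atTop 0] with t ht
    exact aux_int_bound lam hlam F _ 0 (fun t ht => (hM t ht).trans (le_max_left _ _)) t ht
  have hv : ∀ᶠ t in atTop, |∫ s in t..(t + lam), G s| ≤ max M N * lam := by
    filter_upwards [eventually_ge_atTop 0] with t ht
    exact aux_int_bound lam hlam G _ 0 (fun t ht => (hN t ht).trans (le_max_right _ _)) t ht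
  have key : Tendsto (fun t => (∫ s in t..(t + lam), F s) - ∫ s in t..(t + lam), G s)
      atTop (nhds 0) := by
    rw [Metric.tendsto_atTop] at h ⊢
    intro e he
    obtain ⟨T, hT⟩ := h (e / 2 / lam) (by positivity)
    refine ⟨max T 0, fun t ht => ?_⟩
    have ht0 : 0 ≤ t := (le_max_right _ _).trans ht
    have hsub : uIcc t (t + lam) ⊆ Ici 0 := by
      rw [uIcc_of_le (by linarith)]
      exact fun s hs => ht0.trans hs.1
    rw [← intervalIntegral.integral_sub (hF.mono hsub).intervalIntegrable
      (hG.mono hsub).intervalIntegrable, Real.dist_eq, sub_zero]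
    have := aux_int_bound lam hlam (fun s => F s - G s) (e / 2 / lam) T (fun s hs => by
      have := hT s hs
      rw [Real.dist_eq, sub_zero] at this
      exact this.le) t ((le_max_left _ _).trans ht)
    rw [div_mul_cancel₀ _ hlam.ne'] at this
    linarith
  have key' : Tendsto (fun t => (∫ s in t..(t + lam), G s) - ∫ s in t..(t + lam), F s)
      atTop (nhds 0) := by
    simpa using key.neg
  exact ⟨le_antisymm (aux_le_liminf _ _ _ hv hu key') (aux_le_liminf _ _ _ hu hv key),
    le_antisymm (aux_limsup_le _ _ _ hu hv key) (aux_limsup_le _ _ _ hv hu key')⟩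

theorem aux_bdd (β η c x y : ℝ → ℝ)
    (hβbdd : ∃ M, ∀ t ≥ (0:ℝ), |β t| ≤ M)
    (hηbdd : ∃ M, ∀ t ≥ (0:ℝ), |η t| ≤ M)
    (hcbdd : ∃ M, ∀ t ≥ (0:ℝ), |c t| ≤ M)
    (hx : ∃ M, ∀ t ≥ (0:ℝ), |x t| ≤ M)
    (hy : ∃ M, ∀ t ≥ (0:ℝ), |y t| ≤ M) :
    ∃ M, ∀ t ≥ (0:ℝ), |β t * x t - η t * y t - c t| ≤ M := by
  obtain ⟨A, hA⟩ := hβbdd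
  obtain ⟨B, hB⟩ := hηbdd
  obtain ⟨C, hC⟩ := hcbdd
  obtain ⟨D, hD⟩ := hx
  obtain ⟨E, hE⟩ := hy
  refine ⟨A * D + B * E + C, fun t ht => ?_⟩
  have h1 : |β t * x t| ≤ A * D := by
    rw [abs_mul]
    exact mul_le_mul (hA t ht) (hD t ht) (abs_nonneg _) ((abs_nonneg _).trans (hA t ht))
  have h2 : |η t * y t| ≤ B * E := by
    rw [abs_mul]
    exact mul_le_mul (hB t ht) (hE t ht) (abs_nonneg _) ((abs_nonneg _).trans (hB t ht))
  have h3 := abs_sub (β t * x t - η t * y t) (c t)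
  have h4 := abs_sub (β t * x t) (η t * y t)
  linarith [hC t ht]

theorem aux_mul (β d : ℝ → ℝ) (hβbdd : ∃ M, ∀ t ≥ (0:ℝ), |β t| ≤ M)
    (hd : Tendsto d atTop (nhds 0)) : Tendsto (fun t => β t * d t) atTop (nhds 0) := by
  obtain ⟨A, hA⟩ := hβbdd
  refine bdd_le_mul_tendsto_zero' A ?_ hd
  filter_upwards [eventually_ge_atTop 0] with t ht using hA t ht

/-- the thresholds `ℛ^ℓ(λ)` and `ℛ^u(λ)` are independent of the
particular (bounded, mutually asymptotic) solutions used to define them. -/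
theorem stmt_0
    (lam : ℝ) (hlam : 0 < lam)
    (β η c : ℝ → ℝ)
    (hβcont : ContinuousOn β (Ici 0)) (hηcont : ContinuousOn η (Ici 0))
    (hccont : ContinuousOn c (Ici 0))
    (hβbdd : ∃ M, ∀ t ≥ (0:ℝ), |β t| ≤ M)
    (hηbdd : ∃ M, ∀ t ≥ (0:ℝ), |η t| ≤ M)
    (hcbdd : ∃ M, ∀ t ≥ (0:ℝ), |c t| ≤ M)
    (hβnn : ∀ t ≥ (0:ℝ), 0 ≤ β t) (hηnn : ∀ t ≥ (0:ℝ), 0 ≤ η t)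
    (hcnn : ∀ t ≥ (0:ℝ), 0 ≤ c t)
    (g : ℝ → ℝ → ℝ → ℝ)
    (hg : Continuous fun p : ℝ × ℝ × ℝ => g p.1 p.2.1 p.2.2)
    (x₁ z₂ x₁' z₂' : ℝ → ℝ)
    (hx₁cont : ContinuousOn x₁ (Ici 0)) (hz₂cont : ContinuousOn z₂ (Ici 0))
    (hx₁'cont : ContinuousOn x₁' (Ici 0)) (hz₂'cont : ContinuousOn z₂' (Ici 0))
    (hx₁bdd : ∃ M, ∀ t ≥ (0:ℝ), |x₁ t| ≤ M)
    (hz₂bdd : ∃ M, ∀ t ≥ (0:ℝ), |z₂ t| ≤ M)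
    (hx₁'bdd : ∃ M, ∀ t ≥ (0:ℝ), |x₁' t| ≤ M)
    (hz₂'bdd : ∃ M, ∀ t ≥ (0:ℝ), |z₂' t| ≤ M)
    (hx : Tendsto (fun t => x₁ t - x₁' t) atTop (nhds 0))
    (hz : Tendsto (fun t => z₂ t - z₂' t) atTop (nhds 0)) :
    liminf (fun t => ∫ s in t..(t + lam),
        (β s * x₁ s - η s * g (x₁ s) 0 (z₂ s) - c s)) atTop
      = liminf (fun t => ∫ s in t..(t + lam),
        (β s * x₁' s - η s * g (x₁' s) 0 (z₂' s) - c s)) atTop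
    ∧ limsup (fun t => ∫ s in t..(t + lam),
        (β s * x₁ s - η s * g (x₁ s) 0 (z₂ s) - c s)) atTop
      = limsup (fun t => ∫ s in t..(t + lam),
        (β s * x₁' s - η s * g (x₁' s) 0 (z₂' s) - c s)) atTop := by
  obtain ⟨A, hA⟩ := hx₁bdd
  obtain ⟨B, hB⟩ := hz₂bdd
  obtain ⟨A', hA'⟩ := hx₁'bdd
  obtain ⟨B', hB'⟩ := hz₂'bdd
  let R := max (max A A') (max B B')
  let K : Set (ℝ × ℝ × ℝ) := Icc (-R) R ×ˢ ({0} ×ˢ Icc (-R) R)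
  have hK : IsCompact K := isCompact_Icc.prod (isCompact_singleton.prod isCompact_Icc)
  have m1 : ∀ t ≥ (0:ℝ), (x₁ t, (0:ℝ), z₂ t) ∈ K := fun t ht =>
    ⟨abs_le.1 ((hA t ht).trans (by simp [R])), rfl, abs_le.1 ((hB t ht).trans (by simp [R]))⟩
  have m2 : ∀ t ≥ (0:ℝ), (x₁' t, (0:ℝ), z₂' t) ∈ K := fun t ht =>
    ⟨abs_le.1 ((hA' t ht).trans (by simp [R])), rfl, abs_le.1 ((hB' t ht).trans (by simp [R]))⟩
  obtain ⟨C, hC⟩ := hK.exists_bound_of_continuousOn hg.continuousOn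
  have huc := hK.uniformContinuousOn_of_continuous hg.continuousOn
  have hgd : Tendsto (fun t => g (x₁ t) 0 (z₂ t) - g (x₁' t) 0 (z₂' t)) atTop (nhds 0) := by
    rw [Metric.uniformContinuousOn_iff] at huc
    rw [Metric.tendsto_nhds] at hx hz ⊢
    intro e he
    obtain ⟨d, hd, H⟩ := huc e he
    filter_upwards [hx d hd, hz d hd, eventually_ge_atTop 0] with t h1 h2 ht
    have := H _ (m1 t ht) _ (m2 t ht) (by
      rw [Real.dist_eq, sub_zero] at h1 h2
      simp [Prod.dist_eq, Real.dist_eq, h1, h2, hd])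
    simpa [Real.dist_eq] using this
  have c1 : ContinuousOn (fun s => g (x₁ s) 0 (z₂ s)) (Ici 0) :=
    hg.comp_continuousOn (hx₁cont.prodMk (continuousOn_const.prodMk hz₂cont))
  have c2 : ContinuousOn (fun s => g (x₁' s) 0 (z₂' s)) (Ici 0) :=
    hg.comp_continuousOn (hx₁'cont.prodMk (continuousOn_const.prodMk hz₂'cont))
  refine aux_main lam hlam _ _
    (((hβcont.mul hx₁cont).sub (hηcont.mul c1)).sub hccont)
    (((hβcont.mul hx₁'cont).sub (hηcont.mul c2)).sub hccont)
    (aux_bdd β η c x₁ _ hβbdd hηbdd hcbdd ⟨A, hA⟩ ⟨C, fun t ht => hC _ (m1 t ht)⟩)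
    (aux_bdd β η c x₁' _ hβbdd hηbdd hcbdd ⟨A', hA'⟩ ⟨C, fun t ht => hC _ (m2 t ht)⟩) ?_
  have := (aux_mul β _ hβbdd hx).sub (aux_mul η _ hηbdd hgd)
  rw [sub_zero] at this
  refine this.congr fun t => ?_
  ring
end

section
/- Let t₀ ≥ 0, let φ : [t₀,∞) → ℝ be bounded and continuous, and let I : [t₀,∞) → (0,∞) be differentiable with I'(t) ≤ φ(t)I(t) for all t ≥ t₀. If there exist λ > 0 and κ > 0 such that ∫_t^{t+λ} φ(s) ds ≤ −κ for all t ≥ t₀, then I(t) → 0 as t → +∞. -/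
open Filter MeasureTheory Set

/-- a positive differentiable function whose logarithmic derivative is
bounded above by a bounded continuous function with uniformly negative integrals over
windows of length `λ` tends to zero. -/
theorem stmt_4
    (t₀ : ℝ) (ht₀ : 0 ≤ t₀)
    (φ : ℝ → ℝ)
    (hφbdd : ∃ M, ∀ t ≥ t₀, |φ t| ≤ M)
    (hφcont : ContinuousOn φ (Ici t₀))
    (I : ℝ → ℝ)
    (hIpos : ∀ t ≥ t₀, 0 < I t)
    (hIdiff : ∀ t ≥ t₀, DifferentiableAt ℝ I t)
    (hIineq : ∀ t ≥ t₀, deriv I t ≤ φ t * I t)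
    (lam κ : ℝ) (hlam : 0 < lam) (hκ : 0 < κ)
    (hint : ∀ t ≥ t₀, (∫ s in t..(t + lam), φ s) ≤ -κ) :
    Tendsto I atTop (nhds 0) := by
  obtain ⟨M, hM⟩ := hφbdd
  set ψ : ℝ → ℝ := fun t => φ (max t t₀) with hψ
  have hψc : Continuous ψ :=
    hφcont.comp_continuous (by fun_prop) (fun t => le_max_right t t₀)
  have hψe : ∀ t ≥ t₀, ψ t = φ t := fun t ht => by simp only [hψ]; rw [max_eq_left ht]
  have hM0 : 0 ≤ M := (abs_nonneg _).trans (hM t₀ le_rfl)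
  have hψb : ∀ t, |ψ t| ≤ M := fun t => hM _ (le_max_right t t₀)
  set Φ : ℝ → ℝ := fun t => ∫ s in t₀..t, ψ s with hΦ
  have hΦd : ∀ t, HasDerivAt Φ (ψ t) t := fun t => hψc.integral_hasStrictDerivAt t₀ t |>.hasDerivAt
  set g : ℝ → ℝ := fun t => Real.log (I t) - Φ t with hg
  have hgd : ∀ t ≥ t₀, HasDerivAt g (deriv I t / I t - ψ t) t := fun t ht =>
    ((hIdiff t ht).hasDerivAt.log (hIpos t ht).ne').sub (hΦd t)
  have hanti : AntitoneOn g (Ici t₀) := by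
    apply antitoneOn_of_deriv_nonpos (convex_Ici t₀)
    · exact fun t ht => (hgd t ht).continuousAt.continuousWithinAt
    · exact fun t ht => (hgd t (interior_subset ht)).differentiableAt.differentiableWithinAt
    · intro t ht
      have ht' : t₀ ≤ t := interior_subset ht
      rw [(hgd t ht').deriv, hψe t ht', sub_nonpos, div_le_iff₀ (hIpos t ht')]
      exact hIineq t ht'
  have hinc : ∀ a b, t₀ ≤ a → a ≤ b →
      Real.log (I b) ≤ Real.log (I a) + ∫ s in a..b, ψ s := by
    intro a b ha hab
    have h := hanti ha (ha.trans hab : t₀ ≤ b) hab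
    have h2 : (∫ s in t₀..a, ψ s) + ∫ s in a..b, ψ s = ∫ s in t₀..b, ψ s :=
      intervalIntegral.integral_add_adjacent_intervals
        (hψc.intervalIntegrable _ _) (hψc.intervalIntegrable _ _)
    simp only [hg, hΦ] at h
    linarith
  have hstep : ∀ t ≥ t₀, Real.log (I (t + lam)) ≤ Real.log (I t) - κ := by
    intro t ht
    have h := hinc t (t + lam) ht (by linarith)
    have h2 : ∫ s in t..(t + lam), ψ s = ∫ s in t..(t + lam), φ s := by
      apply intervalIntegral.integral_congr
      intro s hs
      rw [uIcc_of_le (by linarith)] at hs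
      exact hψe s (ht.le.trans hs.1)
    have := hint t ht
    linarith
  have hsteps : ∀ n : ℕ, ∀ t ≥ t₀, Real.log (I (t + n * lam)) ≤ Real.log (I t) - n * κ := by
    intro n
    induction n with
    | zero => intro t _; simp
    | succ k ih =>
      intro t ht
      have h1 := ih t ht
      have h2 := hstep (t + k * lam) (by have : 0 ≤ (k : ℝ) * lam := by positivity
                                         linarith)
      have h3 : t + ((k + 1 : ℕ) : ℝ) * lam = t + k * lam + lam := by push_cast; ring
      rw [h3]
      push_cast
      linarith
  have hbound : ∀ t ≥ t₀, I t ≤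
      Real.exp (Real.log (I t₀) + M * lam + κ - (t - t₀) * (κ / lam)) := by
    intro t ht
    have hq : 0 ≤ (t - t₀) / lam := div_nonneg (by linarith) hlam.le
    set n := ⌊(t - t₀) / lam⌋₊ with hn
    have hn1 : (n : ℝ) * lam ≤ t - t₀ := (le_div_iff₀ hlam).1 (Nat.floor_le hq)
    have hn2 : (t - t₀) / lam < n + 1 := Nat.lt_floor_add_one _
    have hn3 : t - t₀ < (n + 1) * lam := (div_lt_iff₀ hlam).1 hn2
    have hs := hsteps n (t - n * lam) (by linarith)
    rw [sub_add_cancel] at hs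
    have h0 := hinc t₀ (t - n * lam) le_rfl (by linarith)
    have h1 : ‖∫ s in t₀..(t - n * lam), ψ s‖ ≤ M * |t - n * lam - t₀| :=
      intervalIntegral.norm_integral_le_of_norm_le_const (fun s _ => hψb s)
    rw [abs_of_nonneg (by linarith : 0 ≤ t - n * lam - t₀), Real.norm_eq_abs] at h1
    have h2 := (le_abs_self _).trans h1
    have h3 : M * (t - n * lam - t₀) ≤ M * lam :=
      mul_le_mul_of_nonneg_left (by linarith) hM0
    have h4 : (t - t₀) * (κ / lam) ≤ (n + 1) * κ := by
      have := mul_le_mul_of_nonneg_right hn2.le hκ.le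
      calc (t - t₀) * (κ / lam) = (t - t₀) / lam * κ := by ring
        _ ≤ _ := this
    rw [← Real.log_le_iff_le_exp (hIpos t ht)]
    linarith
  have hlim : Tendsto (fun t : ℝ =>
      Real.exp (Real.log (I t₀) + M * lam + κ - (t - t₀) * (κ / lam))) atTop (nhds 0) := by
    apply Real.tendsto_exp_atBot.comp
    have h : Tendsto (fun t : ℝ => (t - t₀) * (κ / lam)) atTop atTop :=
      (tendsto_atTop_add_const_right _ (-t₀) tendsto_id).atTop_mul_const (div_pos hκ hlam)
    exact tendsto_atBot_add_const_left _ _ (tendsto_neg_atTop_atBot.comp h)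
  refine tendsto_of_tendsto_of_tendsto_of_le_of_le' tendsto_const_nhds hlim ?_ ?_
  · filter_upwards [eventually_ge_atTop t₀] with t ht using (hIpos t ht).le
  · filter_upwards [eventually_ge_atTop t₀] with t ht using hbound t ht
end

section
/- Let t₀ ≥ 0, let ψ : [t₀,∞) → ℝ be bounded and continuous, and let I : [t₀,∞) → (0,∞) be differentiable with I'(t) ≥ ψ(t)I(t) for all t ≥ t₀ and I(t₀) > 0. If there exist λ > 0 and κ > 0 such that ∫_t^{t+λ} ψ(s) ds ≥ κ for all t ≥ t₀, then I is unbounded on [t₀,∞); in fact I(t) → +∞ as t → +∞. -/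
open Filter MeasureTheory Set

/-- a positive differentiable function whose logarithmic derivative is
bounded below by a bounded continuous function with uniformly positive integrals over
windows of length `λ` tends to `+∞` (in particular, it is unbounded). -/
theorem stmt_5
    (t₀ : ℝ) (ht₀ : 0 ≤ t₀)
    (ψ : ℝ → ℝ)
    (hψbdd : ∃ M, ∀ t ≥ t₀, |ψ t| ≤ M)
    (hψcont : ContinuousOn ψ (Ici t₀))
    (I : ℝ → ℝ)
    (hIpos : ∀ t ≥ t₀, 0 < I t)
    (hI0 : 0 < I t₀)
    (hIdiff : ∀ t ≥ t₀, DifferentiableAt ℝ I t)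
    (hIineq : ∀ t ≥ t₀, ψ t * I t ≤ deriv I t)
    (lam κ : ℝ) (hlam : 0 < lam) (hκ : 0 < κ)
    (hint : ∀ t ≥ t₀, κ ≤ ∫ s in t..(t + lam), ψ s) :
    (¬ ∃ M, ∀ t ≥ t₀, I t ≤ M) ∧ Tendsto I atTop atTop := by
  have key : ∀ a b, t₀ ≤ a → a ≤ b →
      ∫ s in a..b, ψ s ≤ Real.log (I b) - Real.log (I a) := by
    intro a b ha hab
    have hd : ∀ x ≥ t₀, HasDerivAt (fun y => Real.log (I y)) (deriv I x / I x) x :=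
      fun x hx => (hIdiff x hx).hasDerivAt.log (hIpos x hx).ne'
    refine intervalIntegral.integral_le_sub_of_hasDeriv_right_of_le
      (g := fun y => Real.log (I y)) (g' := fun x => deriv I x / I x) hab ?_ ?_ ?_ ?_
    · intro x hx
      exact (hd x (ha.trans hx.1)).continuousAt.continuousWithinAt
    · intro x hx
      exact (hd x (ha.trans hx.1.le)).hasDerivWithinAt
    · exact (hψcont.mono fun x hx => ha.trans hx.1).integrableOn_Icc
    · intro x hx
      have hx' : t₀ ≤ x := ha.trans hx.1.le
      exact (le_div_iff₀ (hIpos x hx')).2 (hIineq x hx')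
  obtain ⟨M, hM⟩ := hψbdd
  have hM0 : 0 ≤ M := (abs_nonneg _).trans (hM t₀ le_rfl)
  have hstep : ∀ (n : ℕ) (a : ℝ), t₀ ≤ a →
      Real.log (I a) + n * κ ≤ Real.log (I (a + n * lam)) := by
    intro n a ha
    induction n with
    | zero => simp
    | succ k ih =>
      have hk : t₀ ≤ a + k * lam := by
        have : 0 ≤ (k : ℝ) * lam := by positivity
        linarith
      have h1 := key (a + k * lam) (a + k * lam + lam) hk (by linarith)
      have h2 := hint _ hk
      have e : a + ((k + 1 : ℕ) : ℝ) * lam = a + k * lam + lam := by push_cast; ring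
      rw [e]
      push_cast
      linarith
  have hlow : ∀ t ≥ t₀,
      Real.log (I t₀) - M * lam - κ + κ * ((t - t₀) / lam) ≤ I t := by
    intro t ht
    have hq : 0 ≤ (t - t₀) / lam := div_nonneg (by linarith) hlam.le
    set n := ⌊(t - t₀) / lam⌋₊ with hn
    have h1 : (n : ℝ) * lam ≤ t - t₀ := (le_div_iff₀ hlam).1 (Nat.floor_le hq)
    have h2 : (t - t₀) / lam < n + 1 := Nat.lt_floor_add_one _
    have h2' : t - t₀ < (n + 1) * lam := (div_lt_iff₀ hlam).1 h2
    have hr : t₀ ≤ t - n * lam := by linarith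
    have h3 := hstep n _ hr
    rw [sub_add_cancel] at h3
    have h4 := key t₀ _ le_rfl hr
    have h5 : ‖∫ s in t₀..(t - n * lam), ψ s‖ ≤ M * |t - n * lam - t₀| := by
      apply intervalIntegral.norm_integral_le_of_norm_le_const
      intro x hx
      rw [uIoc_of_le hr] at hx
      exact hM x hx.1.le
    rw [Real.norm_eq_abs, abs_of_nonneg (by linarith : 0 ≤ t - n * lam - t₀)] at h5
    have h6 := (abs_le.1 h5).1
    have h7 : M * (t - n * lam - t₀) ≤ M * lam :=
      mul_le_mul_of_nonneg_left (by linarith) hM0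
    have h8 := Real.log_le_sub_one_of_pos (hIpos t ht)
    have h9 : κ * ((t - t₀) / lam) ≤ κ * (n + 1) :=
      mul_le_mul_of_nonneg_left h2.le hκ.le
    linarith
  have hT : Tendsto I atTop atTop := by
    refine tendsto_atTop_mono' atTop ((eventually_ge_atTop t₀).mono hlow) ?_
    apply tendsto_atTop_add_const_left
    apply Tendsto.const_mul_atTop hκ
    apply Tendsto.atTop_div_const hlam
    exact tendsto_atTop_add_const_right _ _ tendsto_id
  refine ⟨?_, hT⟩
  rintro ⟨B, hB⟩
  obtain ⟨t, h1, h2⟩ := ((hT.eventually_gt_atTop B).and (eventually_ge_atTop t₀)).exists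
  exact absurd (hB t h2) (not_le.2 h1)
end

section
/- Let T > 0 and let k : ℝ × [0,∞) → ℝ be continuous, T-periodic in t, continuously differentiable in S, bounded from above, with k(t,0) > 0 for every t, ∂k/∂S(t,S) < 0 for every t and every S ≥ 0, and for every t there exists S₁(t) > 0 with k(t,S₁(t)) = 0. Let a, m, b, r, γ be positive constants and β, η, c, θ : [0,∞) → ℝ bounded, nonnegative and continuous with c^ℓ := inf c > 0. Let (S,I,P) be a nonnegative solution, with positive initial conditions, of S' = k(t,S)S − aSP/(m+S+I) − β(t)SI, I' = β(t)SI − η(t)PI − c(t)I, P' = (b − rP)P + γaSP/(m+S+I) + θ(t)η(t)PI. Then limsup_{t→∞} S(t) ≤ S₁^u := max_{t∈[0,T]} S₁(t), limsup_{t→∞}(S(t)+I(t)) ≤ C := (k^u + c^ℓ)S₁^u/c^ℓ where k^u := sup k, and limsup_{t→∞} P(t) ≤ D := (b + γa + θ^u η^u C)/r. In particular a bounded region contains the ω-limit set of every such solution. -/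
open Filter MeasureTheory Set

lemma aux_ev (f f' : ℝ → ℝ) (t₀ L δ : ℝ) (hδ : 0 < δ)
    (hf : ∀ t ≥ t₀, HasDerivAt f (f' t) t) (hnn : ∀ t ≥ t₀, 0 ≤ f t)
    (h : ∀ᶠ t in atTop, L ≤ f t → f' t ≤ -δ) : ∀ᶠ t in atTop, f t ≤ L := by
  obtain ⟨t₂, ht₂⟩ := eventually_atTop.1 h
  set t₁ := max t₀ t₂ with ht₁
  have h1 : ∀ t ≥ t₁, t ≥ t₀ := fun t ht => le_trans (le_max_left _ _) ht
  have h2 : ∀ t ≥ t₁, L ≤ f t → f' t ≤ -δ := fun t ht => ht₂ t (le_trans (le_max_right _ _) ht)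
  -- some time below
  have hex : ∃ s ≥ t₁, f s ≤ L := by
    by_contra! hcon
    have hpos := hnn t₁ (h1 _ le_rfl)
    set s := t₁ + (f t₁ + 1) / δ with hs
    have hs1 : t₁ ≤ s := by
      have : 0 ≤ (f t₁ + 1) / δ := by positivity
      linarith
    have key := image_le_of_deriv_right_le_deriv_boundary (f := f) (f' := f') (a := t₁) (b := s)
      (B := fun x => f t₁ - δ * (x - t₁)) (B' := fun _ => -δ)
      (fun x hx => (hf x (h1 x hx.1)).continuousAt.continuousWithinAt)
      (fun x hx => (hf x (h1 x hx.1)).hasDerivWithinAt) (by simp) (by fun_prop)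
      (fun x _ => by
        have : HasDerivAt (fun x => f t₁ - δ * (x - t₁)) (-δ) x := by
          have := (((hasDerivAt_id x).sub_const t₁).const_mul δ).const_sub (f t₁)
          simpa using this
        exact this.hasDerivWithinAt)
      (fun x hx => h2 x hx.1 (hcon x hx.1).le) (right_mem_Icc.2 hs1)
    have h3 := hnn s (h1 s hs1)
    have h4 : δ * (s - t₁) = f t₁ + 1 := by rw [hs]; field_simp; ring
    linarith
  obtain ⟨s, hs, hsL⟩ := hex
  filter_upwards [eventually_ge_atTop s] with t ht
  exact image_le_of_deriv_right_lt_deriv_boundary (f := f) (f' := f') (a := s) (b := t)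
      (B := fun _ => L) (B' := fun _ => 0)
      (fun x hx => (hf x (h1 x (hs.trans hx.1))).continuousAt.continuousWithinAt)
      (fun x hx => (hf x (h1 x (hs.trans hx.1))).hasDerivWithinAt) hsL
      (fun x => hasDerivAt_const x L)
      (fun x hx he => by
        have := h2 x (hs.trans hx.1) he.ge
        linarith) (right_mem_Icc.2 ht)

lemma aux_limsup (f : ℝ → ℝ) (t₀ L : ℝ) (hnn : ∀ t ≥ t₀, 0 ≤ f t)
    (h : ∀ ε > 0, ∀ᶠ t in atTop, f t ≤ L + ε) : limsup f atTop ≤ L := by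
  refine le_of_forall_pos_le_add fun ε hε => ?_
  refine limsup_le_of_le ?_ (h ε hε)
  refine IsBoundedUnder.isCoboundedUnder_le ⟨0, ?_⟩
  exact (eventually_ge_atTop t₀).mono fun t ht => hnn t ht

/-- STATEMENT 9: boundedness lemma for the eco-epidemiological model with prey vital
dynamics `G(t,S) = k(t,S)S`, Holling-type II response `f(S,I,P) = S/(m+S+I)`,
`g(S,I,P) = P` and predator vital dynamics `h(t,P) = b − rP`. -/
theorem stmt_9
    (T : ℝ) (hT : 0 < T)
    (k kS : ℝ → ℝ → ℝ)
    (hkcont : ContinuousOn (fun p : ℝ × ℝ => k p.1 p.2) (univ ×ˢ Ici 0))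
    (hkper : ∀ t x, k (t + T) x = k t x)
    (hkdiff : ∀ t x, HasDerivAt (fun y => k t y) (kS t x) x)
    (hkScont : ContinuousOn (fun p : ℝ × ℝ => kS p.1 p.2) (univ ×ˢ Ici 0))
    (hk0 : ∀ t, 0 < k t 0)
    (hkSneg : ∀ t, ∀ x ≥ (0:ℝ), kS t x < 0)
    (ku : ℝ) (hku : IsLUB {y | ∃ t x, 0 ≤ x ∧ y = k t x} ku)
    (S₁ : ℝ → ℝ) (hS₁pos : ∀ t, 0 < S₁ t) (hS₁zero : ∀ t, k t (S₁ t) = 0)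
    (S1u : ℝ) (hS1u : IsGreatest (S₁ '' Icc 0 T) S1u)
    (a m b r γ : ℝ)
    (ha : 0 < a) (hm : 0 < m) (hb : 0 < b) (hr : 0 < r) (hγ : 0 < γ)
    (β η c θ : ℝ → ℝ)
    (hβ : ContinuousOn β (Ici 0) ∧ (∀ t ≥ (0:ℝ), 0 ≤ β t) ∧ ∃ M, ∀ t ≥ (0:ℝ), |β t| ≤ M)
    (hη : ContinuousOn η (Ici 0) ∧ (∀ t ≥ (0:ℝ), 0 ≤ η t) ∧ ∃ M, ∀ t ≥ (0:ℝ), |η t| ≤ M)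
    (hc : ContinuousOn c (Ici 0) ∧ (∀ t ≥ (0:ℝ), 0 ≤ c t) ∧ ∃ M, ∀ t ≥ (0:ℝ), |c t| ≤ M)
    (hθ : ContinuousOn θ (Ici 0) ∧ (∀ t ≥ (0:ℝ), 0 ≤ θ t) ∧ ∃ M, ∀ t ≥ (0:ℝ), |θ t| ≤ M)
    (hcl : 0 < sInf (c '' Ici 0))
    (t₀ : ℝ) (ht₀ : 0 ≤ t₀)
    (S I P : ℝ → ℝ)
    (hS : ∀ t ≥ t₀, HasDerivAt S
      (k t (S t) * S t - a * S t * P t / (m + S t + I t) - β t * S t * I t) t)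
    (hI : ∀ t ≥ t₀, HasDerivAt I
      (β t * S t * I t - η t * P t * I t - c t * I t) t)
    (hP : ∀ t ≥ t₀, HasDerivAt P
      ((b - r * P t) * P t + γ * a * S t * P t / (m + S t + I t)
        + θ t * η t * P t * I t) t)
    (hnn : ∀ t ≥ t₀, 0 ≤ S t ∧ 0 ≤ I t ∧ 0 ≤ P t)
    (hinit : 0 < S t₀ ∧ 0 < I t₀ ∧ 0 < P t₀) :
    limsup S atTop ≤ S1u ∧
    limsup (fun t => S t + I t) atTop ≤
      (ku + sInf (c '' Ici 0)) * S1u / sInf (c '' Ici 0) ∧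
    limsup P atTop ≤
      (b + γ * a + sSup (θ '' Ici 0) * sSup (η '' Ici 0) *
        ((ku + sInf (c '' Ici 0)) * S1u / sInf (c '' Ici 0))) / r := by
  have hanti : ∀ t, StrictAntiOn (k t) (Ici 0) := by
    intro t
    refine strictAntiOn_of_deriv_neg (convex_Ici 0)
      (fun x _ => (hkdiff t x).continuousAt.continuousWithinAt) ?_
    intro x hx
    rw [interior_Ici] at hx
    have := (hkdiff t x).deriv
    change deriv (k t) x = _ at this
    rw [this]
    exact hkSneg t x (le_of_lt hx)
  obtain ⟨⟨τ, hτ, hτe⟩, hub⟩ := hS1u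
  have hS1pos : 0 < S1u := hτe ▸ hS₁pos τ
  have hkle : ∀ t x, 0 ≤ x → k t x ≤ ku := fun t x hx => hku.1 ⟨t, x, hx, rfl⟩
  have hkupos : 0 < ku := lt_of_lt_of_le (hk0 0) (hkle 0 0 le_rfl)
  have hkneg : ∀ x, S1u < x → ∃ δ > 0, ∀ t, k t x ≤ -δ := by
    intro x hx
    have hx0 : 0 ≤ x := (hS1pos.trans hx).le
    have hc1 : ContinuousOn (fun t => k t x) (Icc 0 T) := by
      have := hkcont.comp (f := fun t : ℝ => (t, x)) (s := Icc 0 T) (by fun_prop)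
        (fun t _ => ⟨mem_univ _, hx0⟩)
      exact this
    obtain ⟨u, hu, hmax⟩ := isCompact_Icc.exists_isMaxOn (nonempty_Icc.2 hT.le) hc1
    have hlt : k u x < 0 := by
      have h1 : S₁ u ≤ S1u := hub ⟨u, hu, rfl⟩
      have := hanti u (a := S₁ u) (b := x) (hS₁pos u).le hx0 (lt_of_le_of_lt h1 hx)
      rwa [hS₁zero] at this
    refine ⟨-k u x, by linarith, fun t => ?_⟩
    have hper : Function.Periodic (fun t => k t x) T := fun t => hkper t x
    obtain ⟨y, hy, hye⟩ := hper.exists_mem_Ico₀ hT t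
    have := hmax (Ico_subset_Icc_self hy)
    simp only [mem_setOf_eq] at this hye
    linarith
  set cl := sInf (c '' Ici 0) with hcldef
  have hcle : ∀ t ≥ (0:ℝ), cl ≤ c t := fun t ht =>
    csInf_le ⟨0, by rintro _ ⟨s, hs, rfl⟩; exact hc.2.1 s hs⟩ ⟨t, ht, rfl⟩
  set ηu := sSup (η '' Ici 0)
  set θu := sSup (θ '' Ici 0)
  have hηle : ∀ t ≥ (0:ℝ), η t ≤ ηu := fun t ht => by
    obtain ⟨M, hM⟩ := hη.2.2
    exact le_csSup ⟨M, by rintro _ ⟨s, hs, rfl⟩; exact (le_abs_self _).trans (hM s hs)⟩ ⟨t, ht, rfl⟩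
  have hθle : ∀ t ≥ (0:ℝ), θ t ≤ θu := fun t ht => by
    obtain ⟨M, hM⟩ := hθ.2.2
    exact le_csSup ⟨M, by rintro _ ⟨s, hs, rfl⟩; exact (le_abs_self _).trans (hM s hs)⟩ ⟨t, ht, rfl⟩
  have hηu : 0 ≤ ηu := (hη.2.1 0 le_rfl).trans (hηle 0 le_rfl)
  have hθu : 0 ≤ θu := (hθ.2.1 0 le_rfl).trans (hθle 0 le_rfl)
  -- prey
  have evS : ∀ ε > 0, ∀ᶠ t in atTop, S t ≤ S1u + ε := by
    intro ε hε
    obtain ⟨δ, hδ, hk⟩ := hkneg (S1u + ε) (by linarith)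
    refine aux_ev S _ t₀ (S1u + ε) (δ * (S1u + ε)) (by positivity) hS (fun t ht => (hnn t ht).1) ?_
    filter_upwards [eventually_ge_atTop t₀] with t ht hle
    obtain ⟨hs, hi, hp⟩ := hnn t ht
    have hβt := hβ.2.1 t (ht₀.trans ht)
    have e1 : 0 ≤ a * S t * P t / (m + S t + I t) := by positivity
    have e2 : 0 ≤ β t * S t * I t := by positivity
    have e3 : k t (S t) ≤ -δ :=
      ((hanti t).antitoneOn (mem_Ici.2 (by positivity)) hs hle).trans (hk t)
    have e4 : k t (S t) * S t ≤ -δ * S t := mul_le_mul_of_nonneg_right e3 hs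
    have e5 : δ * (S1u + ε) ≤ δ * S t := mul_le_mul_of_nonneg_left hle hδ.le
    linarith
  set C := (ku + cl) * S1u / cl with hC
  have hCpos : 0 < C := by positivity
  have hCcl : cl * C = (ku + cl) * S1u := by rw [hC]; field_simp
  have evN : ∀ ε > 0, ∀ᶠ t in atTop, S t + I t ≤ C + ε := by
    intro ε hε
    refine aux_ev (fun t => S t + I t) _ t₀ (C + ε) (cl * ε / 2) (by positivity)
      (fun t ht => (hS t ht).add (hI t ht))
      (fun t ht => add_nonneg (hnn t ht).1 (hnn t ht).2.1) ?_
    filter_upwards [eventually_ge_atTop t₀, evS (cl * ε / (2 * (ku + cl))) (by positivity)]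
      with t ht hSle hle
    obtain ⟨hs, hi, hp⟩ := hnn t ht
    have hηt := hη.2.1 t (ht₀.trans ht)
    have e1 : 0 ≤ a * S t * P t / (m + S t + I t) := by positivity
    have e2 : 0 ≤ η t * P t * I t := by positivity
    have e3 : k t (S t) * S t ≤ ku * S t := mul_le_mul_of_nonneg_right (hkle _ _ hs) hs
    have e4 : cl * I t ≤ c t * I t := mul_le_mul_of_nonneg_right (hcle t (ht₀.trans ht)) hi
    have e5 : (ku + cl) * S t ≤ (ku + cl) * (S1u + cl * ε / (2 * (ku + cl))) :=
      mul_le_mul_of_nonneg_left hSle (by positivity)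
    have e6 : (ku + cl) * (S1u + cl * ε / (2 * (ku + cl))) = (ku + cl) * S1u + cl * ε / 2 := by
      field_simp
    have e7 : cl * (C + ε) ≤ cl * (S t + I t) := mul_le_mul_of_nonneg_left hle hcl.le
    linarith
  set D := (b + γ * a + θu * ηu * C) / r with hD
  have hDpos : 0 < D := by positivity
  have hDr : r * D = b + γ * a + θu * ηu * C := by rw [hD]; field_simp
  have evP : ∀ ε > 0, ∀ᶠ t in atTop, P t ≤ D + ε := by
    intro ε hε
    refine aux_ev P _ t₀ (D + ε) (r * ε / 2 * ε) (by positivity) hP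
      (fun t ht => (hnn t ht).2.2) ?_
    filter_upwards [eventually_ge_atTop t₀, evN (r * ε / (2 * (θu * ηu + 1))) (by positivity)]
      with t ht hNle hle
    obtain ⟨hs, hi, hp⟩ := hnn t ht
    have ht0 := ht₀.trans ht
    have e1 : S t / (m + S t + I t) ≤ 1 := by
      rw [div_le_one (by positivity)]; linarith
    have e2 : γ * a * (S t / (m + S t + I t)) ≤ γ * a * 1 :=
      mul_le_mul_of_nonneg_left e1 (by positivity)
    have e3 : θ t * η t ≤ θu * ηu :=
      mul_le_mul (hθle t ht0) (hηle t ht0) (hη.2.1 t ht0) hθu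
    have e4 : θ t * η t * I t ≤ θu * ηu * (C + r * ε / (2 * (θu * ηu + 1))) :=
      mul_le_mul e3 (by linarith) hi (by positivity)
    have e5 : θu * ηu * (r * ε / (2 * (θu * ηu + 1))) ≤ r * ε / 2 := by
      have : (θu * ηu + 1) * (r * ε / (2 * (θu * ηu + 1))) = r * ε / 2 := by field_simp
      have h0 : 0 ≤ r * ε / (2 * (θu * ηu + 1)) := by positivity
      linarith
    have e6 : r * (D + ε) ≤ r * P t := mul_le_mul_of_nonneg_left hle hr.le
    have e7 : b - r * P t + γ * a * (S t / (m + S t + I t)) + θ t * η t * I t ≤ -(r * ε / 2) := by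
      linarith
    have e8 := mul_le_mul_of_nonneg_right e7 hp
    have e9 : r * ε / 2 * ε ≤ r * ε / 2 * P t :=
      mul_le_mul_of_nonneg_left (by linarith) (by positivity)
    have e10 : (b - r * P t) * P t + γ * a * S t * P t / (m + S t + I t) + θ t * η t * P t * I t
        = (b - r * P t + γ * a * (S t / (m + S t + I t)) + θ t * η t * I t) * P t := by ring
    rw [e10]
    linarith
  exact ⟨aux_limsup S t₀ _ (fun t ht => (hnn t ht).1) evS,
    aux_limsup _ t₀ _ (fun t ht => add_nonneg (hnn t ht).1 (hnn t ht).2.1) evN,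
    aux_limsup P t₀ _ (fun t ht => (hnn t ht).2.2) evP⟩
end

section
/- Let Λ, μ, a, b, r, γ, θ be positive constants and let β, η, c : [0,∞) → ℝ be nonnegative, continuous and ω-periodic for some ω > 0, with mean values β̄ := (1/ω)∫_0^ω β, η̄ := (1/ω)∫_0^ω η and c̄ := (1/ω)∫_0^ω c, and c̄ > 0. If β̄Λ/μ < η̄b/r + c̄, then for every solution (S,I,P), with positive initial conditions, of the system S' = (Λ − μS)S − aSP − β(t)SI, I' = β(t)SI − η(t)PI − c(t)I, P' = (b − rP)P + γaSP + θη(t)PI, one has I(t) → 0 as t → +∞. -/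
open Filter MeasureTheory Set

/-- A solution of a scalar linear equation with positive initial value stays positive. -/
lemma pos_of_linear (t₀ : ℝ) (u k : ℝ → ℝ) (hk : ContinuousOn k (Ici t₀))
    (hu : ∀ t ≥ t₀, HasDerivAt u (k t * u t) t) (h0 : 0 < u t₀) : ∀ t ≥ t₀, 0 < u t := by
  have hK : Continuous (fun t => k (max t t₀)) :=
    hk.comp_continuous (by fun_prop) (fun t => mem_Ici.2 (le_max_right _ _))
  set Φ : ℝ → ℝ := fun t => ∫ s in t₀..t, k (max s t₀) with hΦ
  have hd : ∀ t ≥ t₀, HasDerivAt Φ (k t) t := by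
    intro t ht
    have := (hK.integral_hasStrictDerivAt t₀ t).hasDerivAt
    simpa [max_eq_left ht] using this
  have hv : ∀ t ≥ t₀, HasDerivAt (fun t => u t * Real.exp (-Φ t)) 0 t := by
    intro t ht
    refine ((hu t ht).mul (hd t ht).neg.exp).congr_deriv ?_
    simp only [Pi.neg_apply]
    ring
  intro t ht
  have hc : u t * Real.exp (-Φ t) = u t₀ * Real.exp (-Φ t₀) := by
    refine constant_of_has_deriv_right_zero (a := t₀) (b := t)
      (f := fun t => u t * Real.exp (-Φ t)) ?_ ?_ t ⟨ht, le_rfl⟩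
    · intro s hs
      exact (hv s hs.1).continuousAt.continuousWithinAt
    · intro s hs
      exact (hv s hs.1).hasDerivWithinAt
  have h1 : 0 < u t * Real.exp (-Φ t) := by
    rw [hc]; positivity
  exact pos_of_mul_pos_left h1 (Real.exp_pos _).le

/-- If `u' ≤ φ' u` on `[T, ∞)`, then `u exp (-φ)` is bounded by its initial value. -/
lemma gronwall_exp (T : ℝ) (u u' φ φ' : ℝ → ℝ)
    (hu : ∀ t ≥ T, HasDerivAt u (u' t) t) (hφ : ∀ t ≥ T, HasDerivAt φ (φ' t) t)
    (hle : ∀ t ≥ T, u' t ≤ φ' t * u t) :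
    ∀ t ≥ T, u t ≤ u T * Real.exp (-φ T) * Real.exp (φ t) := by
  have hv : ∀ t ≥ T, HasDerivAt (fun t => u t * Real.exp (-φ t))
      ((u' t - φ' t * u t) * Real.exp (-φ t)) t := by
    intro t ht
    refine ((hu t ht).mul (hφ t ht).neg.exp).congr_deriv ?_
    simp only [Pi.neg_apply]
    ring
  have hanti : AntitoneOn (fun t => u t * Real.exp (-φ t)) (Ici T) := by
    refine antitoneOn_of_deriv_nonpos (convex_Ici T) ?_ ?_ ?_
    · intro s hs
      exact (hv s hs).continuousAt.continuousWithinAt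
    · intro s hs
      rw [interior_Ici] at hs
      exact (hv s (le_of_lt hs)).differentiableAt.differentiableWithinAt
    · intro s hs
      rw [interior_Ici] at hs
      rw [(hv s (le_of_lt hs)).deriv]
      exact mul_nonpos_of_nonpos_of_nonneg (by linarith [hle s (le_of_lt hs)])
        (Real.exp_pos _).le
  intro t ht
  have h := hanti (mem_Ici.2 le_rfl) (mem_Ici.2 ht) ht
  have h2 := mul_le_mul_of_nonneg_right h (Real.exp_pos (φ t)).le
  have h3 : u t * Real.exp (-φ t) * Real.exp (φ t) = u t := by
    rw [mul_assoc, ← Real.exp_add]; simp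
  simp only at h2
  linarith

/-- Scalar comparison: `u' ≤ -k (u - l)` forces `limsup u ≤ l`. -/
lemma eventually_lt_of_deriv_le (T k l : ℝ) (hk : 0 < k) (u u' : ℝ → ℝ)
    (hu : ∀ t ≥ T, HasDerivAt u (u' t) t) (hle : ∀ t ≥ T, u' t ≤ -k * (u t - l))
    (δ : ℝ) (hδ : 0 < δ) : ∀ᶠ t in atTop, u t < l + δ := by
  have h := gronwall_exp T (fun t => u t - l) u' (fun t => -k * t) (fun _ => -k)
    (fun t ht => (hu t ht).sub_const l)
    (fun t _ => by simpa using (hasDerivAt_id t).const_mul (-k)) hle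
  have ht : Tendsto (fun t : ℝ => -k * t) atTop atBot :=
    tendsto_id.const_mul_atTop_of_neg (by linarith)
  have h2 := (Real.tendsto_exp_atBot.comp ht).const_mul ((u T - l) * Real.exp (-(-k * T)))
  rw [mul_zero] at h2
  filter_upwards [h2.eventually (gt_mem_nhds hδ), eventually_ge_atTop T] with t h3 h4
  have := h t h4
  simp only [Function.comp] at h3 this
  linarith

/-- STATEMENT 13: extinction threshold for the periodic eco-epidemiological model with
logistic prey growth, bilinear predation on susceptible prey and `h(t,P) = b − rP`:
if `β̄Λ/μ < η̄b/r + c̄` then the infectives go to extinction. -/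
theorem stmt_13
    (Λ μ a b r γ θ : ℝ)
    (hΛ : 0 < Λ) (hμ : 0 < μ) (ha : 0 < a) (hb : 0 < b) (hr : 0 < r)
    (hγ : 0 < γ) (hθ : 0 < θ)
    (ω : ℝ) (hω : 0 < ω)
    (β η c : ℝ → ℝ)
    (hβ : Continuous β ∧ (∀ t, 0 ≤ β t) ∧ Function.Periodic β ω)
    (hη : Continuous η ∧ (∀ t, 0 ≤ η t) ∧ Function.Periodic η ω)
    (hc : Continuous c ∧ (∀ t, 0 ≤ c t) ∧ Function.Periodic c ω)
    (hcbar : 0 < (1 / ω) * ∫ s in (0:ℝ)..ω, c s)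
    (hthr : ((1 / ω) * ∫ s in (0:ℝ)..ω, β s) * (Λ / μ) <
      ((1 / ω) * ∫ s in (0:ℝ)..ω, η s) * (b / r) + (1 / ω) * ∫ s in (0:ℝ)..ω, c s) :
    ∀ t₀ ≥ (0:ℝ), ∀ S I P : ℝ → ℝ,
      (∀ t ≥ t₀, HasDerivAt S
        ((Λ - μ * S t) * S t - a * S t * P t - β t * S t * I t) t) →
      (∀ t ≥ t₀, HasDerivAt I
        (β t * S t * I t - η t * P t * I t - c t * I t) t) →
      (∀ t ≥ t₀, HasDerivAt P
        ((b - r * P t) * P t + γ * a * S t * P t + θ * η t * P t * I t) t) →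
      0 < S t₀ → 0 < I t₀ → 0 < P t₀ →
      Tendsto I atTop (nhds 0) := by
  intro t₀ _ S I P hS hI hP hS0 hI0 hP0
  obtain ⟨hβc, hβ0, hβp⟩ := hβ
  obtain ⟨hηc, hη0, hηp⟩ := hη
  obtain ⟨hcc, hc0, hcp⟩ := hc
  have cS : ContinuousOn S (Ici t₀) := fun t ht => (hS t ht).continuousAt.continuousWithinAt
  have cI : ContinuousOn I (Ici t₀) := fun t ht => (hI t ht).continuousAt.continuousWithinAt
  have cP : ContinuousOn P (Ici t₀) := fun t ht => (hP t ht).continuousAt.continuousWithinAt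
  have cβ := hβc.continuousOn (s := Ici t₀)
  have cη := hηc.continuousOn (s := Ici t₀)
  have cc := hcc.continuousOn (s := Ici t₀)
  have pS : ∀ t ≥ t₀, 0 < S t := by
    refine pos_of_linear t₀ S (fun t => Λ - μ * S t - a * P t - β t * I t) (by fun_prop) ?_ hS0
    intro t ht
    convert hS t ht using 1
    ring
  have pI : ∀ t ≥ t₀, 0 < I t := by
    refine pos_of_linear t₀ I (fun t => β t * S t - η t * P t - c t) (by fun_prop) ?_ hI0
    intro t ht
    convert hI t ht using 1
    ring
  have pP : ∀ t ≥ t₀, 0 < P t := by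
    refine pos_of_linear t₀ P (fun t => b - r * P t + γ * a * S t + θ * η t * I t)
      (by fun_prop) ?_ hP0
    intro t ht
    convert hP t ht using 1
    ring
  -- asymptotic bounds
  have bS : ∀ ε > 0, ∀ᶠ t in atTop, S t ≤ Λ / μ + ε := by
    intro ε hε
    have hδ : 0 < μ / Λ - 1 / (Λ / μ + ε) := by
      have : 1 / (Λ / μ + ε) < 1 / (Λ / μ) := by
        apply one_div_lt_one_div_of_lt <;> [positivity; linarith]
      rw [one_div_div] at this
      linarith
    have h := eventually_lt_of_deriv_le t₀ Λ (-(μ / Λ)) hΛ (fun t => -(S t)⁻¹) _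
      (fun t ht => ((hS t ht).inv (pS t ht).ne').neg) ?_ _ hδ
    · filter_upwards [h, eventually_ge_atTop t₀] with t h1 h2
      have h3 : 1 / (Λ / μ + ε) < 1 / S t := by rw [one_div (S t)]; linarith
      exact (lt_of_one_div_lt_one_div (by positivity) h3).le
    · intro t ht
      have p1 := pS t ht
      have e : -(-((Λ - μ * S t) * S t - a * S t * P t - β t * S t * I t) / S t ^ 2)
          = Λ * (S t)⁻¹ - μ - (a * P t + β t * I t) * (S t)⁻¹ := by
        field_simp; ring
      have e2 : -Λ * (-(S t)⁻¹ - -(μ / Λ)) = Λ * (S t)⁻¹ - μ := by field_simp; ring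
      rw [e, e2]
      have := pP t ht
      have := pI t ht
      have := hβ0 t
      have : 0 ≤ (a * P t + β t * I t) * (S t)⁻¹ := by positivity
      linarith
  have bP : ∀ ε > 0, ∀ᶠ t in atTop, b / r - ε ≤ P t := by
    intro ε hε
    rcases le_or_gt (b / r - ε) 0 with hneg | hpos
    · filter_upwards [eventually_ge_atTop t₀] with t ht
      exact hneg.trans (pP t ht).le
    have hδ : 0 < 1 / (b / r - ε) - r / b := by
      have : 1 / (b / r) < 1 / (b / r - ε) := by
        apply one_div_lt_one_div_of_lt <;> linarith
      rw [one_div_div] at this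
      linarith
    have h := eventually_lt_of_deriv_le t₀ b (r / b) hb (fun t => (P t)⁻¹) _
      (fun t ht => ((hP t ht).inv (pP t ht).ne')) ?_ _ hδ
    · filter_upwards [h, eventually_ge_atTop t₀] with t h1 h2
      have h3 : 1 / P t < 1 / (b / r - ε) := by rw [one_div (P t)]; linarith
      exact (lt_of_one_div_lt_one_div (pP t h2) h3).le
    · intro t ht
      have p1 := pP t ht
      have e : -((b - r * P t) * P t + γ * a * S t * P t + θ * η t * P t * I t) / P t ^ 2
          = -b * (P t)⁻¹ + r - (γ * a * S t + θ * η t * I t) * (P t)⁻¹ := by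
        field_simp; ring
      have e2 : -b * ((P t)⁻¹ - r / b) = -b * (P t)⁻¹ + r := by field_simp; ring
      rw [e, e2]
      have := pS t ht
      have := pI t ht
      have := hη0 t
      have : 0 ≤ (γ * a * S t + θ * η t * I t) * (P t)⁻¹ := by positivity
      linarith
  -- the threshold
  set B := ∫ s in (0:ℝ)..ω, β s with hB
  set E := ∫ s in (0:ℝ)..ω, η s with hE
  set C := ∫ s in (0:ℝ)..ω, c s with hC
  have B0 : 0 ≤ B := intervalIntegral.integral_nonneg hω.le (fun t _ => hβ0 t)
  have E0 : 0 ≤ E := intervalIntegral.integral_nonneg hω.le (fun t _ => hη0 t)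
  have hgap : 0 < E * (b / r) + C - B * (Λ / μ) := by
    have h1 := mul_lt_mul_of_pos_left hthr hω
    have e1 : ω * (1 / ω * B * (Λ / μ)) = B * (Λ / μ) := by field_simp
    have e2 : ω * (1 / ω * E * (b / r) + 1 / ω * C) = E * (b / r) + C := by field_simp
    rw [e1, e2] at h1
    linarith
  obtain ⟨ε, hε, hε2⟩ : ∃ ε > 0, 0 < E * (b / r - ε) + C - B * (Λ / μ + ε) := by
    refine ⟨(E * (b / r) + C - B * (Λ / μ)) / (B + E + 1), by positivity, ?_⟩
    set g := E * (b / r) + C - B * (Λ / μ) with hg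
    have e : E * (b / r - g / (B + E + 1)) + C - B * (Λ / μ + g / (B + E + 1))
        = g / (B + E + 1) := by
      have : g = g / (B + E + 1) * (B + E + 1) := by field_simp
      linear_combination (-1 : ℝ) * hg + this
    rw [e]; positivity
  set ψ : ℝ → ℝ := fun t => η t * (b / r - ε) + c t - β t * (Λ / μ + ε) with hψ
  have ψc : Continuous ψ := by fun_prop
  have ψp : Function.Periodic ψ ω := by
    intro t
    simp only [hψ, hβp t, hηp t, hcp t]
  have ψi : 0 < ∫ s in (0:ℝ)..ω, ψ s := by
    have : ∫ s in (0:ℝ)..ω, ψ s = E * (b / r - ε) + C - B * (Λ / μ + ε) := by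
      simp only [hψ]
      rw [intervalIntegral.integral_sub, intervalIntegral.integral_add,
        intervalIntegral.integral_mul_const, intervalIntegral.integral_mul_const]
      all_goals exact Continuous.intervalIntegrable (by fun_prop) _ _
    rw [this]; exact hε2
  have hlim : Tendsto (fun t => ∫ s in (0:ℝ)..t, ψ s) atTop atTop :=
    ψp.tendsto_atTop_intervalIntegral_of_pos ψi hω
  obtain ⟨T, hT⟩ := eventually_atTop.1
    ((bS ε hε).and ((bP ε hε).and (eventually_ge_atTop t₀)))
  have hgr := gronwall_exp T I _ (fun t => -∫ s in (0:ℝ)..t, ψ s) (fun t => -ψ t)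
    (fun t ht => hI t (hT t ht).2.2)
    (fun t _ => ((ψc.integral_hasStrictDerivAt 0 t).hasDerivAt).neg) (by
      intro t ht
      obtain ⟨h1, h2, h3⟩ := hT t ht
      have h4 := mul_le_mul_of_nonneg_left h1 (hβ0 t)
      have h5 := mul_le_mul_of_nonneg_left h2 (hη0 t)
      have h6 : β t * S t - η t * P t - c t ≤ -ψ t := by simp only [hψ]; linarith
      have h7 := mul_le_mul_of_nonneg_right h6 (pI t h3).le
      linarith)
  have hz := (Real.tendsto_exp_atBot.comp (tendsto_neg_atTop_atBot.comp hlim)).const_mul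
    (I T * Real.exp (- -∫ s in (0:ℝ)..T, ψ s))
  rw [mul_zero] at hz
  refine squeeze_zero' ?_ ?_ hz
  · filter_upwards [eventually_ge_atTop t₀] with t ht using (pI t ht).le
  · filter_upwards [eventually_ge_atTop T] with t ht using hgr t ht
end

section
/- Let Λ, μ, a, b, r, γ, θ be positive constants and let β, η, c : [0,∞) → ℝ be nonnegative, continuous and ω-periodic for some ω > 0, with means β̄, η̄, c̄ and c̄ > 0. Suppose Λr > ab + aγΛ/μ, and set z₂* := (bμ + aγΛ)/(μr) and x₁* := (Λ − a z₂*)/μ (so x₁* > 0). If β̄ x₁* > η̄ z₂* + c̄, then the infectives of the system S' = (Λ − μS)S − aSP − β(t)SI, I' = β(t)SI − η(t)PI − c(t)I, P' = (b − rP)P + γaSP + θη(t)PI are uniformly strongly persistent: there exist 0 < m₁ < m₂ such that every solution (S,I,P) with positive initial conditions satisfies m₁ < liminf_{t→∞} I(t) ≤ limsup_{t→∞} I(t) < m₂. -/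
open Filter MeasureTheory Set

lemma aux_int_le (s t : ℝ) (hst : s ≤ t) (u u' h : ℝ → ℝ) (hh : Continuous h)
    (hu : ∀ x ∈ Icc s t, HasDerivAt u (u' x) x) (hle : ∀ x ∈ Icc s t, h x ≤ u' x) :
    ∫ x in s..t, h x ≤ u t - u s := by
  have hH : ∀ x, HasDerivAt (fun y => ∫ z in s..y, h z) (h x) x := fun x =>
    (hh.integral_hasStrictDerivAt s x).hasDerivAt
  have hm : MonotoneOn (fun y => u y - ∫ z in s..y, h z) (Icc s t) := by
    apply monotoneOn_of_deriv_nonneg (convex_Icc s t)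
    · intro x hx
      exact ((hu x hx).sub (hH x)).continuousAt.continuousWithinAt
    · intro x hx
      exact ((hu x (interior_subset hx)).sub (hH x)).differentiableAt.differentiableWithinAt
    · intro x hx
      have := ((hu x (interior_subset hx)).sub (hH x)).deriv
      have h2 := hle x (interior_subset hx)
      have e : deriv (fun y => u y - ∫ z in s..y, h z) x = u' x - h x := this
      rw [e]; linarith
  have := hm (left_mem_Icc.2 hst) (right_mem_Icc.2 hst) hst
  simp at this
  linarith

lemma aux_pos (t₀ : ℝ) (f g : ℝ → ℝ) (hg : ContinuousOn g (Ici t₀))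
    (hf : ∀ t ≥ t₀, HasDerivAt f (f t * g t) t) (h0 : 0 < f t₀) : ∀ t ≥ t₀, 0 < f t := by
  intro t ht
  have hh : Continuous (fun x => g (max t₀ x)) := by
    have : Continuous (fun x => max t₀ x) := by fun_prop
    exact hg.comp_continuous this (fun x => mem_Ici.2 (le_max_left _ _))
  have hH : ∀ x, HasDerivAt (fun y => ∫ z in t₀..y, g (max t₀ z)) (g (max t₀ x)) x := fun x =>
    (hh.integral_hasStrictDerivAt t₀ x).hasDerivAt
  have hd : ∀ x ∈ Icc t₀ t, HasDerivAt
      (fun y => f y * Real.exp (-∫ z in t₀..y, g (max t₀ z))) 0 x := by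
    intro x hx
    have := (hf x hx.1).mul (hH x).neg.exp
    refine this.congr_deriv ?_
    simp only [Pi.neg_apply, max_eq_right hx.1]
    ring_nf
  have h1 := aux_int_le t₀ t ht _ _ (fun _ => 0) continuous_const hd (fun _ _ => le_rfl)
  simp at h1
  have h2 : 0 < f t * Real.exp (-∫ z in t₀..t, g (max t₀ z)) := by linarith
  exact pos_of_mul_pos_left h2 (Real.exp_pos _).le

lemma aux_lin (s t p q : ℝ) (hst : s ≤ t) (hq : 0 < q) (y y' : ℝ → ℝ)
    (hy : ∀ x ∈ Icc s t, HasDerivAt y (y' x) x) (hle : ∀ x ∈ Icc s t, y' x ≤ p - q * y x) :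
    y t - p / q ≤ (y s - p / q) * Real.exp (-(q * (t - s))) := by
  have hd : ∀ x ∈ Icc s t, HasDerivAt (fun x => -((y x - p / q) * Real.exp (q * (x - s))))
      (-(y' x + q * y x - p) * Real.exp (q * (x - s))) x := by
    intro x hx
    have h1 : HasDerivAt (fun x => q * (x - s)) q x := by
      simpa using ((hasDerivAt_id x).sub_const s).const_mul q
    have := (((hy x hx).sub_const (p / q)).mul h1.exp).neg
    refine this.congr_deriv ?_
    field_simp
    ring
  have h1 := aux_int_le s t hst _ _ (fun _ => 0) continuous_const hd (fun x hx => by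
    apply mul_nonneg _ (Real.exp_pos _).le
    linarith [hle x hx])
  simp at h1
  rw [Real.exp_neg, ← div_eq_mul_inv, le_div_iff₀ (Real.exp_pos _)]
  linarith

lemma aux_exp_small (q D δ : ℝ) (hq : 0 < q) (hδ : 0 < δ) :
    ∃ T > 0, ∀ t ≥ T, D * Real.exp (-(q * t)) < δ := by
  have h : Tendsto (fun t : ℝ => D * Real.exp (-(q * t))) atTop (nhds (D * 0)) := by
    apply Tendsto.const_mul
    apply Real.tendsto_exp_neg_atTop_nhds_zero.comp
    exact tendsto_id.const_mul_atTop hq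
  rw [mul_zero] at h
  obtain ⟨T, hT⟩ := eventually_atTop.1 (h.eventually (gt_mem_nhds hδ))
  exact ⟨max T 1, by positivity, fun t ht => hT t (le_trans (le_max_left _ _) ht)⟩

lemma aux_logistic_upper (A r e : ℝ) (hA : 0 < A) (hr : 0 < r) (he : 0 < e) :
    ∃ T > 0, ∀ (v g : ℝ → ℝ) (s t : ℝ), s + T ≤ t →
      (∀ x ∈ Icc s t, 0 < v x) → (∀ x ∈ Icc s t, HasDerivAt v (v x * g x) x) →
      (∀ x ∈ Icc s t, g x ≤ A - r * v x) → v t ≤ A / r + e := by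
  have hp : 0 < r / A - (A / r + e)⁻¹ := by
    rw [sub_pos, ← inv_div A r]
    apply inv_strictAnti₀ (by positivity); linarith
  obtain ⟨T, hT0, hT⟩ := aux_exp_small A (r / A) _ hA hp
  refine ⟨T, hT0, fun v g s t hst hv hd hg => ?_⟩
  have hst' : s ≤ t := by linarith
  have h1 := aux_lin s t (-r) A hst' hA (fun x => -(v x)⁻¹) (fun x => g x / v x)
    (fun x hx => by
      have := ((hd x hx).inv (hv x hx).ne').neg
      refine this.congr_deriv ?_
      have := (hv x hx).ne'
      field_simp) (fun x hx => by
      have h0 := hv x hx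
      have := hg x hx
      rw [div_le_iff₀ h0]
      field_simp
      linarith)
  have h2 := hT (t - s) (by linarith)
  have hs : 0 < (v s)⁻¹ := inv_pos.2 (hv s (left_mem_Icc.2 hst'))
  have ht : 0 < v t := hv t (right_mem_Icc.2 hst')
  have h3 : (A / r + e)⁻¹ ≤ (v t)⁻¹ := by
    have hE := Real.exp_pos (-(A * (t - s)))
    have : 0 < (v s)⁻¹ * Real.exp (-(A * (t - s))) := by positivity
    have e1 : -r / A = - (r / A) := by ring
    rw [e1] at h1
    nlinarith
  exact (inv_le_inv₀ (by positivity) ht).1 h3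

lemma aux_logistic_lower (A r e m : ℝ) (hA : 0 < A) (hr : 0 < r) (he : 0 < e) (hm : 0 < m) :
    ∃ T > 0, ∀ (v g : ℝ → ℝ) (s t : ℝ), s + T ≤ t → m ≤ v s →
      (∀ x ∈ Icc s t, 0 < v x) → (∀ x ∈ Icc s t, HasDerivAt v (v x * g x) x) →
      (∀ x ∈ Icc s t, A - r * v x ≤ g x) → A / r - e ≤ v t := by
  by_cases hneg : A / r - e ≤ 0
  · exact ⟨1, one_pos, fun v g s t hst _ hv _ _ =>
      hneg.trans (hv t (right_mem_Icc.2 (by linarith))).le⟩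
  push Not at hneg
  have hp : 0 < (A / r - e)⁻¹ - r / A := by
    rw [sub_pos, ← inv_div A r]
    apply inv_strictAnti₀ hneg; linarith
  obtain ⟨T, hT0, hT⟩ := aux_exp_small A m⁻¹ _ hA hp
  refine ⟨T, hT0, fun v g s t hst hms hv hd hg => ?_⟩
  have hst' : s ≤ t := by linarith
  have h1 := aux_lin s t r A hst' hA (fun x => (v x)⁻¹) (fun x => -(g x / v x))
    (fun x hx => by
      have := ((hd x hx).inv (hv x hx).ne')
      refine this.congr_deriv ?_
      have := (hv x hx).ne'
      field_simp) (fun x hx => by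
      have h0 := hv x hx
      have := hg x hx
      rw [← neg_div, div_le_iff₀ h0]
      field_simp
      linarith)
  have h2 := hT (t - s) (by linarith)
  have hs : (v s)⁻¹ ≤ m⁻¹ := inv_anti₀ hm hms
  have ht : 0 < v t := hv t (right_mem_Icc.2 hst')
  have h3 : (v t)⁻¹ ≤ (A / r - e)⁻¹ := by
    have hE := Real.exp_pos (-(A * (t - s)))
    have h4 := mul_le_mul_of_nonneg_right hs hE.le
    have : 0 < r / A * Real.exp (-(A * (t - s))) := by positivity
    nlinarith
  exact (inv_le_inv₀ ht hneg).1 h3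

lemma aux_bdd_s13 (ω : ℝ) (hω : 0 < ω) (h : ℝ → ℝ) (hh : Continuous h) (hp : Function.Periodic h ω) :
    ∃ C > 0, ∀ t, |h t| ≤ C := by
  obtain ⟨C, hC⟩ := (isCompact_Icc (a := (0:ℝ)) (b := ω)).exists_bound_of_continuousOn
    hh.continuousOn
  refine ⟨max C 1, by positivity, fun t => ?_⟩
  obtain ⟨y, hy, e⟩ := hp.exists_mem_Ico₀ hω t
  rw [e]
  exact (hC y (Ico_subset_Icc_self hy)).trans (le_max_left _ _)

lemma aux_mean (ω : ℝ) (hω : 0 < ω) (h : ℝ → ℝ) (hh : Continuous h)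
    (hp : Function.Periodic h ω) :
    ∃ C > 0, ∀ s t, |(∫ x in s..t, h x) - ((1 / ω) * ∫ x in (0:ℝ)..ω, h x) * (t - s)| ≤ C := by
  set m := (1 / ω) * ∫ x in (0:ℝ)..ω, h x with hm
  have hint : ∀ a b, IntervalIntegrable h volume a b := fun a b => hh.intervalIntegrable a b
  have hG : Continuous (fun t => (∫ x in (0:ℝ)..t, h x) - m * t) := by
    apply Continuous.sub _ (by fun_prop)
    exact intervalIntegral.continuous_primitive hint 0
  have hGp : Function.Periodic (fun t => (∫ x in (0:ℝ)..t, h x) - m * t) ω := by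
    intro t
    have h1 := intervalIntegral.integral_add_adjacent_intervals (hint 0 t) (hint t (t + ω))
    have h2 := hp.intervalIntegral_add_eq t 0
    rw [zero_add] at h2
    have h3 : m * ω = ∫ x in (0:ℝ)..ω, h x := by rw [hm]; field_simp
    simp only
    rw [← h1, h2, mul_add, h3]; ring
  obtain ⟨C, hC, hb⟩ := aux_bdd_s13 ω hω _ hG hGp
  refine ⟨2 * C, by positivity, fun s t => ?_⟩
  have h1 := intervalIntegral.integral_add_adjacent_intervals (hint 0 s) (hint s t)
  have hs := abs_le.1 (hb s)
  have ht := abs_le.1 (hb t)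
  rw [abs_le]
  constructor <;> nlinarith

lemma aux_excursion (K L T t₁ : ℝ) (hK : 0 ≤ K) (hT : 0 < T) (u : ℝ → ℝ)
    (h1 : ∀ s t, t₁ ≤ s → s ≤ t → u s - K * (t - s) ≤ u t)
    (h2 : ∀ s, t₁ ≤ s → (∀ x ∈ Icc s (s + T), u x ≤ L) → u s + 1 ≤ u (s + T)) :
    ∃ t₂, ∀ t ≥ t₂, L - 2 * K * T ≤ u t := by
  have key : ∀ n : ℕ, min (u t₁ + n) (L - K * T) ≤ u (t₁ + n * T) := by
    intro n
    induction n with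
    | zero => simp
    | succ k ih =>
      have hk : t₁ ≤ t₁ + k * T := by
        have : 0 ≤ (k:ℝ) * T := by positivity
        linarith
      have e : t₁ + ((k + 1 : ℕ) : ℝ) * T = t₁ + k * T + T := by push_cast; ring
      rw [e]
      by_cases hx : ∀ x ∈ Icc (t₁ + k * T) (t₁ + k * T + T), u x ≤ L
      · have := h2 _ hk hx
        rcases min_le_iff.1 ih with h | h
        · refine (min_le_left _ _).trans ?_
          push_cast; linarith
        · refine (min_le_right _ _).trans ?_
          linarith
      · push Not at hx
        obtain ⟨x, hx, hL⟩ := hx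
        have := h1 x (t₁ + k * T + T) (hk.trans hx.1) hx.2
        refine (min_le_right _ _).trans ?_
        have : K * (t₁ + k * T + T - x) ≤ K * T := by
          apply mul_le_mul_of_nonneg_left _ hK
          linarith [hx.1]
        linarith
  obtain ⟨N, hN⟩ := exists_nat_ge (L - K * T - u t₁)
  refine ⟨t₁ + N * T, fun t ht => ?_⟩
  have hnn : 0 ≤ (t - t₁) / T := by
    apply div_nonneg _ hT.le
    have : 0 ≤ (N:ℝ) * T := by positivity
    linarith
  set n := ⌊(t - t₁) / T⌋₊ with hn
  have a1 : (n:ℝ) ≤ (t - t₁) / T := Nat.floor_le hnn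
  have a2 : (t - t₁) / T < n + 1 := Nat.lt_floor_add_one _
  rw [le_div_iff₀ hT] at a1
  rw [div_lt_iff₀ hT] at a2
  have a3 : N ≤ n := by
    apply Nat.le_floor
    rw [le_div_iff₀ hT]; linarith
  have a3' : (N:ℝ) ≤ n := by exact_mod_cast a3
  have a4 := key n
  rw [min_eq_right (by linarith)] at a4
  have a5 := h1 (t₁ + n * T) t (by have : 0 ≤ (n:ℝ) * T := by positivity
                                   linarith) (by linarith)
  have : K * (t - (t₁ + n * T)) ≤ K * T := by
    apply mul_le_mul_of_nonneg_left _ hK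
    linarith
  linarith

lemma aux_log_lower (s t : ℝ) (hst : s ≤ t) (v g h : ℝ → ℝ) (hh : Continuous h)
    (hv : ∀ x ∈ Icc s t, 0 < v x) (hd : ∀ x ∈ Icc s t, HasDerivAt v (v x * g x) x)
    (hle : ∀ x ∈ Icc s t, h x ≤ g x) :
    ∫ x in s..t, h x ≤ Real.log (v t) - Real.log (v s) := by
  refine aux_int_le s t hst (fun x => Real.log (v x)) g h hh (fun x hx => ?_) hle
  have h0 := (hv x hx).ne'
  refine ((hd x hx).log h0).congr_deriv ?_
  field_simp

lemma aux_log_upper (s t : ℝ) (hst : s ≤ t) (v g h : ℝ → ℝ) (hh : Continuous h)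
    (hv : ∀ x ∈ Icc s t, 0 < v x) (hd : ∀ x ∈ Icc s t, HasDerivAt v (v x * g x) x)
    (hle : ∀ x ∈ Icc s t, g x ≤ h x) :
    Real.log (v t) - Real.log (v s) ≤ ∫ x in s..t, h x := by
  have := aux_int_le s t hst (fun x => -Real.log (v x)) (fun x => -g x) (fun x => -h x) hh.neg
    (fun x hx => by
      have h0 := (hv x hx).ne'
      refine ((hd x hx).log h0).neg.congr_deriv ?_
      field_simp) (fun x hx => neg_le_neg (hle x hx))
  rw [intervalIntegral.integral_neg] at this
  linarith

/-- Data of the model. -/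
structure EcoPar (Λ μ a b r γ θ ω B E C bm em cm : ℝ) (β η c : ℝ → ℝ) : Prop where
  hΛ : 0 < Λ
  hμ : 0 < μ
  ha : 0 < a
  hb : 0 < b
  hr : 0 < r
  hγ : 0 < γ
  hθ : 0 < θ
  hω : 0 < ω
  cβ : Continuous β
  cη : Continuous η
  cc : Continuous c
  nβ : ∀ t, 0 ≤ β t
  nη : ∀ t, 0 ≤ η t
  nc : ∀ t, 0 ≤ c t
  pβ : Function.Periodic β ω
  pη : Function.Periodic η ω
  pc : Function.Periodic c ω
  B0 : 0 < B
  E0 : 0 < E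
  C0 : 0 < C
  lB : ∀ t, β t ≤ B
  lE : ∀ t, η t ≤ E
  lC : ∀ t, c t ≤ C
  hbm : bm = (1 / ω) * ∫ s in (0:ℝ)..ω, β s
  hem : em = (1 / ω) * ∫ s in (0:ℝ)..ω, η s
  hcm : cm = (1 / ω) * ∫ s in (0:ℝ)..ω, c s
  cm0 : 0 < cm

/-- Positive solutions of the model on `[t₀, ∞)`. -/
structure EcoSol (Λ μ a b r γ θ : ℝ) (β η c : ℝ → ℝ) (t₀ : ℝ) (S I P : ℝ → ℝ) : Prop where
  dS : ∀ t ≥ t₀, HasDerivAt S (S t * (Λ - μ * S t - a * P t - β t * I t)) t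
  dI : ∀ t ≥ t₀, HasDerivAt I (I t * (β t * S t - η t * P t - c t)) t
  dP : ∀ t ≥ t₀, HasDerivAt P (P t * (b - r * P t + γ * a * S t + θ * η t * I t)) t
  pS : ∀ t ≥ t₀, 0 < S t
  pI : ∀ t ≥ t₀, 0 < I t
  pP : ∀ t ≥ t₀, 0 < P t

section Eco

variable {Λ μ a b r γ θ ω B E C bm em cm : ℝ} {β η c : ℝ → ℝ}

lemma eco_mean (H : EcoPar Λ μ a b r γ θ ω B E C bm em cm β η c) (p q k d : ℝ) :
    ∃ D > 0, ∀ s t, |(∫ x in s..t, (p * β x + q * η x + k * c x + d)) -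
      (p * bm + q * em + k * cm + d) * (t - s)| ≤ D := by
  have h1 := H.cβ
  have h2 := H.cη
  have h3 := H.cc
  obtain ⟨D, hD, h⟩ := aux_mean ω H.hω (fun x => p * β x + q * η x + k * c x + d)
    (by fun_prop) (by
      intro x
      simp only [H.pβ x, H.pη x, H.pc x])
  refine ⟨D, hD, fun s t => ?_⟩
  have e : (1 / ω) * (∫ x in (0:ℝ)..ω, (p * β x + q * η x + k * c x + d)) =
      p * bm + q * em + k * cm + d := by
    rw [intervalIntegral.integral_add, intervalIntegral.integral_add,
      intervalIntegral.integral_add, H.hbm, H.hem, H.hcm]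
    · simp only [intervalIntegral.integral_const_mul, intervalIntegral.integral_const]
      have := H.hω.ne'
      simp only [sub_zero, smul_eq_mul]
      field_simp
    all_goals
      apply Continuous.intervalIntegrable
      fun_prop
  rw [← e]
  exact h s t

lemma eco_S_upper (H : EcoPar Λ μ a b r γ θ ω B E C bm em cm β η c) (e : ℝ) (he : 0 < e)
    (t₀ : ℝ) (S I P : ℝ → ℝ) (X : EcoSol Λ μ a b r γ θ β η c t₀ S I P) :
    ∃ t₁ ≥ t₀, ∀ t ≥ t₁, S t ≤ Λ / μ + e := by
  obtain ⟨T, hT, h⟩ := aux_logistic_upper Λ μ e H.hΛ H.hμ he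
  refine ⟨t₀ + T, by linarith, fun t ht => ?_⟩
  refine h S _ t₀ t ht (fun x hx => X.pS x hx.1) (fun x hx => X.dS x hx.1) (fun x hx => ?_)
  have h1 := mul_pos H.ha (X.pP x hx.1)
  have h2 := mul_nonneg (H.nβ x) (X.pI x hx.1).le
  linarith

lemma eco_I_upper (H : EcoPar Λ μ a b r γ θ ω B E C bm em cm β η c) :
    ∃ M > 0, ∀ (t₀ : ℝ) (S I P : ℝ → ℝ), EcoSol Λ μ a b r γ θ β η c t₀ S I P →
    ∃ t₁ ≥ t₀, ∀ t ≥ t₁, I t ≤ M := by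
  have hΛ := H.hΛ
  have hμ := H.hμ
  have hC := H.C0
  have hcm := H.cm0
  obtain ⟨D, hD, hmean⟩ := eco_mean H 0 0 (-1) (cm / 2)
  set MS := Λ / μ + 1 with hMS
  have hMS0 : 0 < MS := by positivity
  set K := (Λ + C) * MS with hK
  have hK0 : 0 < K := by positivity
  set L₀ := 2 * K / cm with hL
  have hL0 : 0 < L₀ := by positivity
  set T := 2 * (D + 1) / cm with hT
  have hT0 : 0 < T := by positivity
  refine ⟨Real.exp (Real.log L₀ + 2 * Λ * T), Real.exp_pos _, fun t₀ S I P X => ?_⟩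
  obtain ⟨t₁, ht₁, hS⟩ := eco_S_upper H 1 one_pos t₀ S I P X
  have hN0 : ∀ x ≥ t₀, 0 < S x + I x := fun x hx => add_pos (X.pS x hx) (X.pI x hx)
  have hNd : ∀ x ≥ t₀, HasDerivAt (fun x => S x + I x) ((S x + I x) *
      ((S x * (Λ - μ * S x - a * P x) - I x * (η x * P x + c x)) / (S x + I x))) x := by
    intro x hx
    refine ((X.dS x hx).add (X.dI x hx)).congr_deriv ?_
    have := (hN0 x hx).ne'
    field_simp
    ring
  have hg1 : ∀ x ≥ t₀, S x * (Λ - μ * S x - a * P x) - I x * (η x * P x + c x) ≤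
      Λ * S x - c x * I x := by
    intro x hx
    have h1 := X.pS x hx
    have h2 := X.pI x hx
    have h3 := X.pP x hx
    have h4 : 0 ≤ S x * (μ * S x + a * P x) := by have := H.ha; positivity
    have h5 : 0 ≤ I x * (η x * P x) := by have := H.nη x; positivity
    nlinarith
  obtain ⟨t₂, ht₂⟩ := aux_excursion Λ (-Real.log L₀) T t₁ hΛ.le hT0
    (fun x => -Real.log (S x + I x)) (fun s t hs hst => by
      have := aux_log_upper s t hst _ _ (fun _ => Λ) continuous_const
        (fun x hx => hN0 x (by linarith [hx.1])) (fun x hx => hNd x (by linarith [hx.1]))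
        (fun x hx => by
          have hx0 : x ≥ t₀ := by linarith [hx.1]
          rw [div_le_iff₀ (hN0 x hx0)]
          have h1 := hg1 x hx0
          have h2 := mul_pos hΛ (X.pI x hx0)
          have h3 := mul_nonneg (H.nc x) (X.pI x hx0).le
          linarith)
      simp only [intervalIntegral.integral_const, smul_eq_mul] at this
      linarith) (fun s hs hx => by
      have := aux_log_upper s (s + T) (by linarith) _ _
        (fun x => 0 * β x + 0 * η x + (-1) * c x + cm / 2)
        (by have h1 := H.cβ
            have h2 := H.cη
            have h3 := H.cc
            fun_prop)
        (fun x hx => hN0 x (by linarith [hx.1])) (fun x hx => hNd x (by linarith [hx.1]))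
        (fun x hxx => by
          have hx0 : x ≥ t₀ := by linarith [hxx.1]
          have hxL := hx x hxx
          have hN := hN0 x hx0
          have h0 : L₀ ≤ S x + I x := by
            rw [neg_le_neg_iff] at hxL
            exact (Real.log_le_log_iff hL0 hN).1 hxL
          rw [div_le_iff₀ hN]
          have h1 := hg1 x hx0
          have h2 : S x ≤ MS := hS x (by linarith [hxx.1])
          have h3 : (Λ + c x) * S x ≤ K := by
            have := H.lC x
            have h4 := H.nc x
            have h5 := X.pS x hx0
            rw [hK]; gcongr
          have h4 : cm / 2 * L₀ = K := by rw [hL]; field_simp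
          have h5 : cm / 2 * L₀ ≤ cm / 2 * (S x + I x) := by gcongr
          nlinarith)
      have h6 := (abs_le.1 (hmean s (s + T))).2
      have h7 : cm / 2 * T = D + 1 := by rw [hT]; field_simp
      have h8 : (0 * bm + 0 * em + (-1) * cm + cm / 2) * (s + T - s) = -(D + 1) := by
        rw [← h7]; ring
      rw [h8] at h6
      linarith)
  refine ⟨max t₁ t₂, ht₁.trans (le_max_left _ _), fun t ht => ?_⟩
  have hx0 : t ≥ t₀ := ht₁.trans ((le_max_left _ _).trans ht)
  have h1 := ht₂ t ((le_max_right _ _).trans ht)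
  have h2 : S t + I t ≤ Real.exp (Real.log L₀ + 2 * Λ * T) := by
    rw [← Real.log_le_iff_le_exp (hN0 t hx0)]
    linarith
  linarith [X.pS t hx0]

lemma eco_P_gen (H : EcoPar Λ μ a b r γ θ ω B E C bm em cm β η c) (ms mi e : ℝ)
    (hms : 0 < ms) (hmi : 0 < mi) (he : 0 < e) :
    ∃ T > 0, ∀ (t₀ : ℝ) (S I P : ℝ → ℝ), EcoSol Λ μ a b r γ θ β η c t₀ S I P →
    ∀ s ≥ t₀, ∀ t, s + T ≤ t → (∀ x ∈ Icc s t, S x ≤ ms) → (∀ x ∈ Icc s t, I x ≤ mi) →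
      P t ≤ (b + γ * a * ms + θ * E * mi) / r + e := by
  have := H.hb
  have := H.hγ
  have := H.ha
  have := H.hθ
  have := H.E0
  obtain ⟨T, hT, h⟩ := aux_logistic_upper (b + γ * a * ms + θ * E * mi) r e
    (by positivity) H.hr he
  refine ⟨T, hT, fun t₀ S I P X s hs t hst hS hI => ?_⟩
  refine h P _ s t hst (fun x hx => X.pP x (hs.trans hx.1)) (fun x hx => X.dP x (hs.trans hx.1))
    (fun x hx => ?_)
  have h1 : γ * a * S x ≤ γ * a * ms := by have := hS x hx; gcongr
  have h2 : θ * η x * I x ≤ θ * E * mi := by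
    have := hI x hx
    have := H.lE x
    have := H.nη x
    have := X.pI x (hs.trans hx.1)
    gcongr
  linarith

lemma eco_bounds (H : EcoPar Λ μ a b r γ θ ω B E C bm em cm β η c) (e : ℝ) (he : 0 < e) :
    ∃ MI > 0, ∃ MP > 0, ∀ (t₀ : ℝ) (S I P : ℝ → ℝ), EcoSol Λ μ a b r γ θ β η c t₀ S I P →
    ∃ t₁ ≥ t₀, ∀ t ≥ t₁, S t ≤ Λ / μ + e ∧ I t ≤ MI ∧ P t ≤ MP := by
  obtain ⟨MI, hMI, hI⟩ := eco_I_upper H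
  have := H.hb
  have := H.hγ
  have := H.ha
  have := H.hθ
  have := H.E0
  have := H.hΛ
  have := H.hμ
  have := H.hr
  obtain ⟨T, hT, hP⟩ := eco_P_gen H (Λ / μ + e) MI 1 (by positivity) hMI one_pos
  refine ⟨MI, hMI, (b + γ * a * (Λ / μ + e) + θ * E * MI) / r + 1, ?_, fun t₀ S I P X => ?_⟩
  rotate_left
  · obtain ⟨t₁, h1, hS⟩ := eco_S_upper H e he t₀ S I P X
    obtain ⟨t₂, h2, hI⟩ := hI t₀ S I P X
    have a1 := le_max_left t₁ t₂
    have a2 := le_max_right t₁ t₂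
    refine ⟨max t₁ t₂ + T, by linarith, fun t ht => ⟨hS t (by linarith), hI t (by linarith), ?_⟩⟩
    exact hP t₀ S I P X (max t₁ t₂) (by linarith) t ht (fun x hx => hS x (by linarith [hx.1]))
      (fun x hx => hI x (by linarith [hx.1]))
  · positivity

lemma eco_S_lower (H : EcoPar Λ μ a b r γ θ ω B E C bm em cm β η c) (e z : ℝ) (he : 0 < e)
    (hz : (b + γ * a * (Λ / μ + e) + θ * E * e) / r + e ≤ z)
    (h1 : 0 < Λ - a * z - B * e - μ * e) (h2 : bm * e < cm) :
    ∃ s₀ > 0, ∀ (t₀ : ℝ) (S I P : ℝ → ℝ), EcoSol Λ μ a b r γ θ β η c t₀ S I P →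
    ∃ t₁ ≥ t₀, ∀ t ≥ t₁, s₀ ≤ S t := by
  have ha := H.ha
  have hΛ := H.hΛ
  have hμ := H.hμ
  have hB := H.B0
  obtain ⟨MI, hMI, MP, hMP, hbd⟩ := eco_bounds H e he
  obtain ⟨T₂, hT₂, hP⟩ := eco_P_gen H (Λ / μ + e) e e (by positivity) he he
  obtain ⟨D, hD, hmean⟩ := eco_mean H e 0 (-1) 0
  set κ := cm - bm * e with hκ
  have hκ0 : 0 < κ := by linarith
  set T₁ := (D + |Real.log MI - Real.log e|) / κ with hT₁
  have hT₁0 : 0 < T₁ := by positivity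
  set K := μ * (Λ / μ + e) + a * MP + B * MI with hK
  have hK0 : 0 < K := by positivity
  set δ := Λ - a * z - B * e - μ * e with hδ
  set T₃ := (1 + K * (T₁ + T₂)) / δ with hT₃
  have hT₃0 : 0 < T₃ := by positivity
  set T := T₁ + T₂ + T₃ with hT
  have hT0 : 0 < T := by positivity
  refine ⟨Real.exp (Real.log e - 2 * K * T), Real.exp_pos _, fun t₀ S I P X => ?_⟩
  obtain ⟨t₁, ht₁, hb⟩ := hbd t₀ S I P X
  have hlip : ∀ s t, t₁ ≤ s → s ≤ t → Real.log (S s) - K * (t - s) ≤ Real.log (S t) := by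
    intro s t hs hst
    have := aux_log_lower s t hst S _ (fun _ => -K) continuous_const
      (fun x hx => X.pS x (by linarith [hx.1])) (fun x hx => X.dS x (by linarith [hx.1]))
      (fun x hx => by
        obtain ⟨b1, b2, b3⟩ := hb x (by linarith [hx.1])
        have i0 := X.pI x (by linarith [hx.1])
        have c1 : μ * S x ≤ μ * (Λ / μ + e) := by gcongr
        have c2 : a * P x ≤ a * MP := by gcongr
        have c3 : β x * I x ≤ B * MI := by
          have := H.lB x
          have := H.nβ x
          gcongr
        linarith)
    simp only [intervalIntegral.integral_const, smul_eq_mul] at this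
    linarith
  obtain ⟨t₂, ht₂⟩ := aux_excursion K (Real.log e) T t₁ hK0.le hT0 (fun x => Real.log (S x)) hlip
    (fun s hs hx => by
      have hSe : ∀ x ∈ Icc s (s + T), S x ≤ e := fun x hxx =>
        (Real.log_le_log_iff (X.pS x (by linarith [hxx.1])) he).1 (hx x hxx)
      have hIe : ∀ x ∈ Icc (s + T₁) (s + T), I x ≤ e := by
        intro x hxx
        have hsx : s ≤ x := by linarith [hxx.1]
        have := aux_log_upper s x hsx I _
          (fun x => e * β x + 0 * η x + (-1) * c x + 0)
          (by have h1 := H.cβ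
              have h2 := H.cη
              have h3 := H.cc
              fun_prop)
          (fun y hy => X.pI y (by linarith [hy.1])) (fun y hy => X.dI y (by linarith [hy.1]))
          (fun y hy => by
            have c1 : β y * S y ≤ β y * e :=
              mul_le_mul_of_nonneg_left (hSe y ⟨hy.1, hy.2.trans hxx.2⟩) (H.nβ y)
            have c2 := mul_nonneg (H.nη y) (X.pP y (by linarith [hy.1])).le
            linarith)
        have h6 := (abs_le.1 (hmean s x)).2
        have h7 : κ * T₁ = D + |Real.log MI - Real.log e| := by rw [hT₁]; field_simp
        have h8 : κ * T₁ ≤ κ * (x - s) := by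
          apply mul_le_mul_of_nonneg_left _ hκ0.le; linarith [hxx.1]
        have h9 : (e * bm + 0 * em + (-1) * cm + 0) * (x - s) = -(κ * (x - s)) := by
          rw [hκ]; ring
        rw [h9] at h6
        have h10 := le_abs_self (Real.log MI - Real.log e)
        have is0 := X.pI s (by linarith)
        have ix0 := X.pI x (by linarith)
        have h11 : Real.log (I s) ≤ Real.log MI := Real.log_le_log is0 (hb s hs).2.1
        apply (Real.log_le_log_iff ix0 he).1
        linarith
      have hPz : ∀ x ∈ Icc (s + T₁ + T₂) (s + T), P x ≤ z := by
        intro x hxx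
        refine le_trans (hP t₀ S I P X (s + T₁) (by linarith) x hxx.1 (fun y hy => ?_)
          (fun y hy => ?_)) hz
        · exact (hb y (by linarith [hy.1])).1
        · exact hIe y ⟨hy.1, hy.2.trans hxx.2⟩
      have g1 := hlip s (s + T₁ + T₂) hs (by linarith)
      have g2 := aux_log_lower (s + T₁ + T₂) (s + T) (by linarith) S _ (fun _ => δ)
        continuous_const
        (fun x hx => X.pS x (by linarith [hx.1])) (fun x hx => X.dS x (by linarith [hx.1]))
        (fun x hx => by
          have b1 := hPz x hx
          have b2 := hIe x ⟨by linarith [hx.1], hx.2⟩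
          have b3 := hSe x ⟨by linarith [hx.1], hx.2⟩
          have i0 := X.pI x (by linarith [hx.1])
          have c1 : μ * S x ≤ μ * e := by gcongr
          have c2 : a * P x ≤ a * z := by gcongr
          have c3 : β x * I x ≤ B * e := by
            have := H.lB x
            have := H.nβ x
            gcongr
          linarith)
      simp only [intervalIntegral.integral_const, smul_eq_mul] at g2
      have g3 : T₃ * δ = 1 + K * (T₁ + T₂) := by rw [hT₃]; field_simp
      have g4 : s + T - (s + T₁ + T₂) = T₃ := by rw [hT]; ring
      have g5 : s + T₁ + T₂ - s = T₁ + T₂ := by ring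
      rw [g4] at g2
      rw [g5] at g1
      linarith)
  refine ⟨max t₁ t₂, ht₁.trans (le_max_left _ _), fun t ht => ?_⟩
  have hx0 : t ≥ t₀ := ht₁.trans ((le_max_left _ _).trans ht)
  have h1 := ht₂ t ((le_max_right _ _).trans ht)
  rw [← Real.le_log_iff_exp_le (X.pS t hx0)]
  exact h1

lemma eco_I_lower (H : EcoPar Λ μ a b r γ θ ω B E C bm em cm β η c) (e z : ℝ) (he : 0 < e)
    (hz : (b + γ * a * (Λ / μ + e) + θ * E * e) / r + e ≤ z)
    (h1 : 0 < Λ - a * z - B * e - μ * e) (h2 : bm * e < cm)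
    (h3 : 0 < bm * ((Λ - a * z - B * e) / μ - e) - em * z - cm) :
    ∃ m > 0, ∀ (t₀ : ℝ) (S I P : ℝ → ℝ), EcoSol Λ μ a b r γ θ β η c t₀ S I P →
    ∃ t₁ ≥ t₀, ∀ t ≥ t₁, m ≤ I t := by
  have ha := H.ha
  have hΛ := H.hΛ
  have hμ := H.hμ
  have hB := H.B0
  have hE := H.E0
  have hC := H.C0
  obtain ⟨MI, hMI, MP, hMP, hbd⟩ := eco_bounds H e he
  obtain ⟨T₁, hT₁, hP⟩ := eco_P_gen H (Λ / μ + e) e e (by positivity) he he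
  obtain ⟨s₀, hs₀, hSl⟩ := eco_S_lower H e z he hz h1 h2
  have hA : 0 < Λ - a * z - B * e := by have := mul_pos hμ he; linarith
  obtain ⟨T₂, hT₂, hlow⟩ := aux_logistic_lower (Λ - a * z - B * e) μ e s₀ hA hμ he hs₀
  set x₁ := (Λ - a * z - B * e) / μ - e with hx₁
  obtain ⟨D, hD, hmean⟩ := eco_mean H x₁ (-z) (-1) 0
  set κ := bm * x₁ - em * z - cm with hκ
  set K := E * MP + C with hK
  have hK0 : 0 < K := by positivity
  set T₃ := (1 + D + K * (T₁ + T₂)) / κ with hT₃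
  have hT₃0 : 0 < T₃ := by positivity
  set T := T₁ + T₂ + T₃ with hT
  have hT0 : 0 < T := by positivity
  refine ⟨Real.exp (Real.log e - 2 * K * T), Real.exp_pos _, fun t₀ S I P X => ?_⟩
  obtain ⟨t₁, ht₁, hb1⟩ := hbd t₀ S I P X
  obtain ⟨t₁', ht₁', hb2⟩ := hSl t₀ S I P X
  obtain ⟨τ, hτ, hb, hbS⟩ : ∃ τ ≥ t₀, (∀ t ≥ τ, S t ≤ Λ / μ + e ∧ I t ≤ MI ∧ P t ≤ MP) ∧
      (∀ t ≥ τ, s₀ ≤ S t) := ⟨max t₁ t₁', ht₁.trans (le_max_left _ _),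
        fun t ht => hb1 t ((le_max_left _ _).trans ht),
        fun t ht => hb2 t ((le_max_right _ _).trans ht)⟩
  have hlip : ∀ s t, τ ≤ s → s ≤ t → Real.log (I s) - K * (t - s) ≤ Real.log (I t) := by
    intro s t hs hst
    have := aux_log_lower s t hst I _ (fun _ => -K) continuous_const
      (fun x hx => X.pI x (by linarith [hx.1])) (fun x hx => X.dI x (by linarith [hx.1]))
      (fun x hx => by
        obtain ⟨b1, b2, b3⟩ := hb x (by linarith [hx.1])
        have p0 := X.pP x (by linarith [hx.1])
        have c1 := mul_nonneg (H.nβ x) (X.pS x (by linarith [hx.1])).le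
        have c3 : η x * P x ≤ E * MP := by
          have := H.lE x
          have := H.nη x
          gcongr
        have := H.lC x
        linarith)
    simp only [intervalIntegral.integral_const, smul_eq_mul] at this
    linarith
  obtain ⟨t₂, ht₂⟩ := aux_excursion K (Real.log e) T τ hK0.le hT0 (fun x => Real.log (I x)) hlip
    (fun s hs hx => by
      have hIe : ∀ x ∈ Icc s (s + T), I x ≤ e := fun x hxx =>
        (Real.log_le_log_iff (X.pI x (by linarith [hxx.1])) he).1 (hx x hxx)
      have hPz : ∀ x ∈ Icc (s + T₁) (s + T), P x ≤ z := by
        intro x hxx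
        refine le_trans (hP t₀ S I P X s (by linarith) x hxx.1 (fun y hy => ?_)
          (fun y hy => ?_)) hz
        · exact (hb y (by linarith [hy.1])).1
        · exact hIe y ⟨hy.1, hy.2.trans hxx.2⟩
      have hSx : ∀ x ∈ Icc (s + T₁ + T₂) (s + T), x₁ ≤ S x := by
        intro x hxx
        refine hlow S _ (s + T₁) x hxx.1 (hbS _ (by linarith))
          (fun y hy => X.pS y (by linarith [hy.1])) (fun y hy => X.dS y (by linarith [hy.1]))
          (fun y hy => ?_)
        have b1 := hPz y ⟨hy.1, hy.2.trans hxx.2⟩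
        have b2 := hIe y ⟨by linarith [hy.1], hy.2.trans hxx.2⟩
        have i0 := X.pI y (by linarith [hy.1])
        have c2 : a * P y ≤ a * z := by gcongr
        have c3 : β y * I y ≤ B * e := by
          have := H.lB y
          have := H.nβ y
          gcongr
        linarith
      have g1 := hlip s (s + T₁ + T₂) hs (by linarith)
      have g2 := aux_log_lower (s + T₁ + T₂) (s + T) (by linarith) I _
        (fun x => x₁ * β x + (-z) * η x + (-1) * c x + 0)
        (by have h1 := H.cβ
            have h2 := H.cη
            have h3 := H.cc
            fun_prop)
        (fun x hx => X.pI x (by linarith [hx.1])) (fun x hx => X.dI x (by linarith [hx.1]))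
        (fun x hx => by
          have b1 := mul_le_mul_of_nonneg_left (hPz x ⟨by linarith [hx.1], hx.2⟩) (H.nη x)
          have b2 := mul_le_mul_of_nonneg_left (hSx x hx) (H.nβ x)
          linarith)
      have h6 := (abs_le.1 (hmean (s + T₁ + T₂) (s + T))).1
      have g3 : κ * T₃ = 1 + D + K * (T₁ + T₂) := by rw [hT₃]; field_simp
      have g4 : (x₁ * bm + (-z) * em + (-1) * cm + 0) * (s + T - (s + T₁ + T₂)) = κ * T₃ := by
        rw [hT, hκ]; ring
      have g5 : s + T₁ + T₂ - s = T₁ + T₂ := by ring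
      rw [g4] at h6
      rw [g5] at g1
      linarith)
  refine ⟨max τ t₂, hτ.trans (le_max_left _ _), fun t ht => ?_⟩
  have hx0 : t ≥ t₀ := hτ.trans ((le_max_left _ _).trans ht)
  have h1 := ht₂ t ((le_max_right _ _).trans ht)
  rw [← Real.le_log_iff_exp_le (X.pI t hx0)]
  exact h1

end Eco

/-- STATEMENT 14: persistence threshold for the periodic eco-epidemiological model with
logistic prey growth, bilinear predation on susceptible prey and `h(t,P) = b − rP`:
if `Λr > ab + aγΛ/μ` and `β̄x₁* > η̄z₂* + c̄`, with `z₂* = (bμ + aγΛ)/(μr)` and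
`x₁* = (Λ − a z₂*)/μ`, then the infectives are uniformly strongly persistent. -/
theorem stmt_14
    (Λ μ a b r γ θ : ℝ)
    (hΛ : 0 < Λ) (hμ : 0 < μ) (ha : 0 < a) (hb : 0 < b) (hr : 0 < r)
    (hγ : 0 < γ) (hθ : 0 < θ)
    (ω : ℝ) (hω : 0 < ω)
    (β η c : ℝ → ℝ)
    (hβ : Continuous β ∧ (∀ t, 0 ≤ β t) ∧ Function.Periodic β ω)
    (hη : Continuous η ∧ (∀ t, 0 ≤ η t) ∧ Function.Periodic η ω)
    (hc : Continuous c ∧ (∀ t, 0 ≤ c t) ∧ Function.Periodic c ω)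
    (hcbar : 0 < (1 / ω) * ∫ s in (0:ℝ)..ω, c s)
    (hexist : Λ * r > a * b + a * γ * Λ / μ)
    (hthr : ((1 / ω) * ∫ s in (0:ℝ)..ω, β s) *
        ((Λ - a * ((b * μ + a * γ * Λ) / (μ * r))) / μ) >
      ((1 / ω) * ∫ s in (0:ℝ)..ω, η s) * ((b * μ + a * γ * Λ) / (μ * r)) +
        (1 / ω) * ∫ s in (0:ℝ)..ω, c s) :
    ∃ m₁ m₂ : ℝ, 0 < m₁ ∧ m₁ < m₂ ∧
      ∀ t₀ ≥ (0:ℝ), ∀ S I P : ℝ → ℝ,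
        (∀ t ≥ t₀, HasDerivAt S
          ((Λ - μ * S t) * S t - a * S t * P t - β t * S t * I t) t) →
        (∀ t ≥ t₀, HasDerivAt I
          (β t * S t * I t - η t * P t * I t - c t * I t) t) →
        (∀ t ≥ t₀, HasDerivAt P
          ((b - r * P t) * P t + γ * a * S t * P t + θ * η t * P t * I t) t) →
        0 < S t₀ → 0 < I t₀ → 0 < P t₀ →
        m₁ < liminf I atTop ∧ liminf I atTop ≤ limsup I atTop ∧
          limsup I atTop < m₂ := by
  obtain ⟨B, hB, hBb⟩ := aux_bdd_s13 ω hω β hβ.1 hβ.2.2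
  obtain ⟨E, hE, hEb⟩ := aux_bdd_s13 ω hω η hη.1 hη.2.2
  obtain ⟨C, hC, hCb⟩ := aux_bdd_s13 ω hω c hc.1 hc.2.2
  obtain ⟨bm, hbm⟩ : ∃ x, x = (1 / ω) * ∫ s in (0:ℝ)..ω, β s := ⟨_, rfl⟩
  obtain ⟨em, hem⟩ : ∃ x, x = (1 / ω) * ∫ s in (0:ℝ)..ω, η s := ⟨_, rfl⟩
  obtain ⟨cm, hcm⟩ : ∃ x, x = (1 / ω) * ∫ s in (0:ℝ)..ω, c s := ⟨_, rfl⟩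
  rw [← hbm, ← hem, ← hcm] at hthr
  rw [← hcm] at hcbar
  have H : EcoPar Λ μ a b r γ θ ω B E C bm em cm β η c :=
    { hΛ := hΛ, hμ := hμ, ha := ha, hb := hb, hr := hr, hγ := hγ, hθ := hθ, hω := hω
      cβ := hβ.1, cη := hη.1, cc := hc.1, nβ := hβ.2.1, nη := hη.2.1, nc := hc.2.1
      pβ := hβ.2.2, pη := hη.2.2, pc := hc.2.2, B0 := hB, E0 := hE, C0 := hC
      lB := fun t => (le_abs_self _).trans (hBb t)
      lE := fun t => (le_abs_self _).trans (hEb t)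
      lC := fun t => (le_abs_self _).trans (hCb t)
      hbm := hbm, hem := hem, hcm := hcm, cm0 := hcbar }
  have hz2 : (b + γ * a * (Λ / μ + 0) + θ * E * 0) / r + 0 =
      (b * μ + a * γ * Λ) / (μ * r) := by field_simp; ring
  set Z : ℝ → ℝ := fun e => (b + γ * a * (Λ / μ + e) + θ * E * e) / r + e with hZ
  have hZ0 : Z 0 = (b * μ + a * γ * Λ) / (μ * r) := hz2
  have hZc : Continuous Z := by
    rw [hZ]
    fun_prop
  have hpos : 0 < Λ - a * Z 0 := by
    rw [hZ0]
    have hz0 : 0 < (b * μ + a * γ * Λ) / (μ * r) := by positivity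
    have hbm0 : 0 ≤ bm := by
      rw [hbm]
      exact mul_nonneg (by positivity)
        (intervalIntegral.integral_nonneg hω.le (fun x _ => hβ.2.1 x))
    have hem0 : 0 ≤ em := by
      rw [hem]
      exact mul_nonneg (by positivity)
        (intervalIntegral.integral_nonneg hω.le (fun x _ => hη.2.1 x))
    have hp := mul_nonneg hem0 hz0.le
    have hq : 0 < (Λ - a * ((b * μ + a * γ * Λ) / (μ * r))) / μ :=
      pos_of_mul_pos_right (lt_trans (by linarith) hthr) hbm0
    exact (div_pos_iff_of_pos_right hμ).1 hq
  have ev1 : ∀ᶠ e in nhds (0:ℝ), 0 < Λ - a * Z e - B * e - μ * e := by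
    have hcont : Continuous (fun e => Λ - a * Z e - B * e - μ * e) := by fun_prop
    refine hcont.continuousAt.eventually (lt_mem_nhds ?_)
    simpa using hpos
  have ev2 : ∀ᶠ e in nhds (0:ℝ), bm * e < cm := by
    have hcont : Continuous (fun e : ℝ => bm * e) := by fun_prop
    refine hcont.continuousAt.eventually (gt_mem_nhds ?_)
    simpa using hcbar
  have ev3 : ∀ᶠ e in nhds (0:ℝ),
      0 < bm * ((Λ - a * Z e - B * e) / μ - e) - em * Z e - cm := by
    have hcont : Continuous (fun e => bm * ((Λ - a * Z e - B * e) / μ - e) - em * Z e - cm) := by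
      fun_prop
    refine hcont.continuousAt.eventually (lt_mem_nhds ?_)
    simp only [mul_zero, sub_zero, hZ0]
    linarith
  obtain ⟨e, ⟨h1, h2, h3⟩, he⟩ :=
    (((ev1.and (ev2.and ev3)).filter_mono nhdsWithin_le_nhds).and
      (self_mem_nhdsWithin : Ioi (0:ℝ) ∈ nhdsWithin 0 (Ioi 0))).exists
  have he : 0 < e := he
  obtain ⟨m, hm, hlow⟩ := eco_I_lower H e (Z e) he le_rfl h1 h2 h3
  obtain ⟨M, hM, hup⟩ := eco_I_upper H
  refine ⟨m / 2, M + m, by positivity, by linarith, ?_⟩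
  intro t₀ _ S I P dS dI dP S0 I0 P0
  have cS : ContinuousOn S (Ici t₀) := fun x hx => (dS x hx).continuousAt.continuousWithinAt
  have cI : ContinuousOn I (Ici t₀) := fun x hx => (dI x hx).continuousAt.continuousWithinAt
  have cP : ContinuousOn P (Ici t₀) := fun x hx => (dP x hx).continuousAt.continuousWithinAt
  have cβ := hβ.1.continuousOn (s := Ici t₀)
  have cη := hη.1.continuousOn (s := Ici t₀)
  have cc := hc.1.continuousOn (s := Ici t₀)
  have dS' : ∀ t ≥ t₀, HasDerivAt S (S t * (Λ - μ * S t - a * P t - β t * I t)) t :=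
    fun t ht => (dS t ht).congr_deriv (by ring)
  have dI' : ∀ t ≥ t₀, HasDerivAt I (I t * (β t * S t - η t * P t - c t)) t :=
    fun t ht => (dI t ht).congr_deriv (by ring)
  have dP' : ∀ t ≥ t₀, HasDerivAt P
      (P t * (b - r * P t + γ * a * S t + θ * η t * I t)) t :=
    fun t ht => (dP t ht).congr_deriv (by ring)
  have X : EcoSol Λ μ a b r γ θ β η c t₀ S I P :=
    { dS := dS', dI := dI', dP := dP'
      pS := aux_pos t₀ S (fun t => Λ - μ * S t - a * P t - β t * I t) (by fun_prop) dS' S0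
      pI := aux_pos t₀ I (fun t => β t * S t - η t * P t - c t) (by fun_prop) dI' I0
      pP := aux_pos t₀ P (fun t => b - r * P t + γ * a * S t + θ * η t * I t)
        (by fun_prop) dP' P0 }
  obtain ⟨t₁, _, hl⟩ := hlow t₀ S I P X
  obtain ⟨t₂, _, hu⟩ := hup t₀ S I P X
  have el : ∀ᶠ t in atTop, m ≤ I t := eventually_atTop.2 ⟨t₁, hl⟩
  have eu : ∀ᶠ t in atTop, I t ≤ M := eventually_atTop.2 ⟨t₂, hu⟩
  have bl : IsBoundedUnder (· ≥ ·) atTop I := ⟨m, by simpa using el⟩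
  have bu : IsBoundedUnder (· ≤ ·) atTop I := ⟨M, by simpa using eu⟩
  refine ⟨?_, liminf_le_limsup bu bl, ?_⟩
  · have := le_liminf_of_le bu.isCoboundedUnder_ge el
    linarith
  · have := limsup_le_of_le bl.isCoboundedUnder_le eu
    linarith
end

section
/- Let T > 0 and let k : ℝ × [0,∞) → ℝ be continuous, T-periodic in t, continuously differentiable in S, bounded from above, with k(t,0) > 0, ∂k/∂S < 0 everywhere, and for every t some S₁(t) > 0 with k(t,S₁(t)) = 0. Let a, m, b, r, γ be positive constants and β, η, c, θ : [0,∞) → ℝ bounded, nonnegative and continuous with inf c > 0. Let s* be a bounded solution of s' = k(t,s)s with positive initial condition, bounded away from zero and globally attractive on (0,∞), and let y* be a solution of y' = (b − ry)y with positive initial condition. If there exists λ > 0 with limsup_{t→∞} ∫_t^{t+λ} [β(s)s*(s) − η(s)y*(s) − c(s)] ds < 0, then for every solution (S,I,P), with positive initial conditions, of S' = k(t,S)S − aSP/(m+S+I) − β(t)SI, I' = β(t)SI − η(t)PI − c(t)I, P' = (b − rP)P + γaSP/(m+S+I) + θ(t)η(t)PI, one has I(t) → 0 as t → +∞. -/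
open Filter MeasureTheory Set

lemma aux_pos_s14 (x A : ℝ → ℝ) (t₀ : ℝ) (hx : ∀ t ≥ t₀, HasDerivAt x (A t * x t) t)
    (h0 : 0 < x t₀)
    (hA : ∀ τ ≥ t₀, (∀ t ∈ Icc t₀ τ, 0 ≤ x t) → ContinuousOn A (Icc t₀ τ)) :
    ∀ t ≥ t₀, 0 < x t := by
  have key : ∀ τ ≥ t₀, (∀ t ∈ Icc t₀ τ, 0 ≤ x t) → 0 < x τ := by
    intro τ hτ hnn
    obtain ⟨M, hM⟩ := (isCompact_Icc.bddBelow_image (hA τ hτ hnn))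
    have hM' : ∀ t ∈ Icc t₀ τ, M ≤ A t := fun t ht => hM (mem_image_of_mem _ ht)
    have hd : ∀ t ≥ t₀, HasDerivAt (fun t => x t * Real.exp (-M * t))
        (A t * x t * Real.exp (-M * t) + x t * (Real.exp (-M * t) * (-M * 1))) t := by
      intro t ht
      exact (hx t ht).mul (((hasDerivAt_id t).const_mul (-M)).exp)
    have hmono : MonotoneOn (fun t => x t * Real.exp (-M * t)) (Icc t₀ τ) := by
      apply monotoneOn_of_deriv_nonneg (convex_Icc _ _)
      · exact fun t ht => (hd t ht.1).continuousAt.continuousWithinAt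
      · intro t ht
        rw [interior_Icc] at ht
        exact (hd t ht.1.le).differentiableAt.differentiableWithinAt
      · intro t ht
        rw [interior_Icc] at ht
        rw [(hd t ht.1.le).deriv]
        have h1 := hM' t ⟨ht.1.le, ht.2.le⟩
        have h2 := hnn t ⟨ht.1.le, ht.2.le⟩
        have h3 := Real.exp_pos (-M * t)
        have : A t * x t * Real.exp (-M * t) + x t * (Real.exp (-M * t) * (-M * 1))
          = (A t - M) * x t * Real.exp (-M * t) := by ring
        rw [this]
        exact mul_nonneg (mul_nonneg (by linarith) h2) h3.le
    have h1 := hmono (left_mem_Icc.2 hτ) (right_mem_Icc.2 hτ) hτ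
    have h2 : 0 < x t₀ * Real.exp (-M * t₀) := mul_pos h0 (Real.exp_pos _)
    exact pos_of_mul_pos_left (lt_of_lt_of_le h2 h1) (Real.exp_pos _).le
  intro τ hτ
  by_contra hneg
  push Not at hneg
  have hcont : ContinuousOn x (Icc t₀ τ) :=
    fun t ht => (hx t ht.1).continuousAt.continuousWithinAt
  let Z := Icc t₀ τ ∩ x ⁻¹' (Iic 0)
  have hZc : IsClosed Z := hcont.preimage_isClosed_of_isClosed isClosed_Icc isClosed_Iic
  have hZne : Z.Nonempty := ⟨τ, ⟨hτ, le_rfl⟩, hneg⟩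
  have hZb : BddBelow Z := ⟨t₀, fun t ht => ht.1.1⟩
  have hm := hZc.csInf_mem hZne hZb
  set σ := sInf Z
  have hlt : ∀ t, t₀ ≤ t → t < σ → 0 < x t := by
    intro t h1 h2
    by_contra h3
    push Not at h3
    have : t ∈ Z := ⟨⟨h1, h2.le.trans hm.1.2⟩, h3⟩
    exact absurd (csInf_le hZb this) (not_le.2 h2)
  have hσ0 : t₀ < σ := by
    rcases eq_or_lt_of_le hm.1.1 with h | h
    · have := hm.2
      rw [← h] at this
      exact absurd h0 (not_lt.2 this)
    · exact h
  have hσnn : 0 ≤ x σ := by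
    have h1 : Tendsto x (nhdsWithin σ (Iio σ)) (nhds (x σ)) :=
      (hx σ hm.1.1).continuousAt.tendsto.mono_left nhdsWithin_le_nhds
    apply ge_of_tendsto h1
    filter_upwards [Ioo_mem_nhdsLT hσ0] with t ht
    exact (hlt t ht.1.le ht.2).le
  have := key σ hm.1.1 (by
    intro t ht
    rcases eq_or_lt_of_le ht.2 with h | h
    · rw [h]; exact hσnn
    · exact (hlt t ht.1 h).le)
  exact absurd this (not_lt.2 hm.2)

lemma aux_evle (w w' : ℝ → ℝ) (t₁ ρ δ : ℝ) (hδ : 0 < δ)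
    (hw : ∀ t ≥ t₁, HasDerivAt w (w' t) t)
    (h : ∀ t ≥ t₁, ρ ≤ w t → w' t ≤ -δ) :
    ∃ t₂ ≥ t₁, ∀ t ≥ t₂, w t ≤ ρ := by
  have h1 : ∃ t₂ ≥ t₁, w t₂ ≤ ρ := by
    by_contra hcon
    push Not at hcon
    have hmono : AntitoneOn (fun t => w t + δ * t) (Ici t₁) := by
      have hd : ∀ t ≥ t₁, HasDerivAt (fun t => w t + δ * t) (w' t + δ * 1) t :=
        fun t ht => (hw t ht).add ((hasDerivAt_id t).const_mul δ)
      apply antitoneOn_of_deriv_nonpos (convex_Ici _)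
      · exact fun t ht => (hd t ht).continuousAt.continuousWithinAt
      · intro t ht
        rw [interior_Ici] at ht
        exact (hd t (le_of_lt ht)).differentiableAt.differentiableWithinAt
      · intro t ht
        rw [interior_Ici] at ht
        have ht' : t ≥ t₁ := le_of_lt ht
        rw [(hd t ht').deriv]
        have := h t ht' (hcon t ht').le
        linarith
    have hq : 0 < (w t₁ - ρ) / δ := div_pos (by linarith [hcon t₁ le_rfl]) hδ
    have h2 := hmono (self_mem_Ici) (show t₁ + (w t₁ - ρ) / δ ∈ Ici t₁ by
      simp only [mem_Ici]; linarith) (by linarith)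
    have h3 := hcon (t₁ + (w t₁ - ρ) / δ) (by linarith)
    have h4 : δ * ((w t₁ - ρ) / δ) = w t₁ - ρ := by field_simp
    simp only [mul_add, h4] at h2
    linarith
  obtain ⟨t₂, ht₂, hle⟩ := h1
  refine ⟨t₂, ht₂, fun t ht => ?_⟩
  refine image_le_of_deriv_right_lt_deriv_boundary (f := w) (f' := w') (a := t₂) (b := t)
    (B := fun _ => ρ) (B' := fun _ => 0) ?_ ?_ hle ?_ ?_ (right_mem_Icc.2 ht)
  · exact fun s hs => (hw s (ht₂.trans hs.1)).continuousAt.continuousWithinAt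
  · exact fun s hs => (hw s (ht₂.trans hs.1)).hasDerivWithinAt
  · exact fun s => hasDerivAt_const s ρ
  · intro s hs he
    have := h s (ht₂.trans hs.1) he.ge
    linarith

lemma aux_tendsto (J : ℝ → ℝ) (t₁ lam α : ℝ) (hlam : 0 < lam) (hα : 0 < α)
    (hJ : ContinuousOn J (Ici t₁)) (h : ∀ t ≥ t₁, J (t + lam) ≤ J t - α) :
    Tendsto J atTop atBot := by
  obtain ⟨B, hB⟩ := isCompact_Icc.bddAbove_image
    (f := fun t => J t + α / lam * t) (K := Icc t₁ (t₁ + lam))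
    ((hJ.mono (fun t ht => ht.1)).add (by fun_prop))
  have hstep : ∀ n : ℕ, ∀ t ∈ Icc t₁ (t₁ + lam),
      J (t + n * lam) + α / lam * (t + n * lam) ≤ B := by
    intro n
    induction n with
    | zero =>
      intro t ht
      simpa using hB (mem_image_of_mem _ ht)
    | succ n ih =>
      intro t ht
      have h1 := ih t ht
      have h2 := h (t + n * lam) (by
        have : (0:ℝ) ≤ n * lam := by positivity
        linarith [ht.1])
      have e : t + ((n + 1 : ℕ) : ℝ) * lam = t + n * lam + lam := by push_cast; ring
      have e2 : α / lam * (t + n * lam + lam) = α / lam * (t + n * lam) + α := by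
        field_simp
      rw [e, e2]
      linarith
  have hall : ∀ t ≥ t₁, J t ≤ B - α / lam * t := by
    intro t ht
    have hq : 0 ≤ (t - t₁) / lam := div_nonneg (by linarith) hlam.le
    have h1 := Nat.floor_le hq
    have h2 := Nat.lt_floor_add_one ((t - t₁) / lam)
    set n := ⌊(t - t₁) / lam⌋₊
    rw [le_div_iff₀ hlam] at h1
    rw [div_lt_iff₀ hlam] at h2
    have := hstep n (t - n * lam) ⟨by linarith, by linarith⟩
    rw [sub_add_cancel] at this
    linarith
  have hlim : Tendsto (fun t : ℝ => B - α / lam * t) atTop atBot := by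
    have h1 : Tendsto (fun t : ℝ => α / lam * t) atTop atTop :=
      tendsto_id.const_mul_atTop (by positivity)
    have h2 := tendsto_atBot_add_const_left atTop B (tendsto_neg_atTop_atBot.comp h1)
    refine h2.congr fun t => ?_
    simp [sub_eq_add_neg]
  exact tendsto_atBot_mono' atTop ((eventually_ge_atTop t₁).mono hall) hlim

set_option maxHeartbeats 1000000 in
/-- STATEMENT 15: extinction for the eco-epidemiological model with prey vital dynamics
`G(t,S) = k(t,S)S`, Holling-type II response `f(S,I,P) = S/(m+S+I)`, `g(S,I,P) = P`
and predator vital dynamics `h(t,P) = b − rP`. -/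
theorem stmt_15
    (T : ℝ) (hT : 0 < T)
    (k kS : ℝ → ℝ → ℝ)
    (hkcont : ContinuousOn (fun p : ℝ × ℝ => k p.1 p.2) (univ ×ˢ Ici 0))
    (hkper : ∀ t x, k (t + T) x = k t x)
    (hkdiff : ∀ t x, HasDerivAt (fun y => k t y) (kS t x) x)
    (hkScont : ContinuousOn (fun p : ℝ × ℝ => kS p.1 p.2) (univ ×ˢ Ici 0))
    (hkbdd : ∃ K, ∀ t, ∀ x ≥ (0:ℝ), k t x ≤ K)
    (hk0 : ∀ t, 0 < k t 0)
    (hkSneg : ∀ t x, kS t x < 0)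
    (S₁ : ℝ → ℝ) (hS₁pos : ∀ t, 0 < S₁ t) (hS₁zero : ∀ t, k t (S₁ t) = 0)
    (a m b r γ : ℝ)
    (ha : 0 < a) (hm : 0 < m) (hb : 0 < b) (hr : 0 < r) (hγ : 0 < γ)
    (β η c θ : ℝ → ℝ)
    (hβ : ContinuousOn β (Ici 0) ∧ (∀ t ≥ (0:ℝ), 0 ≤ β t) ∧ ∃ M, ∀ t ≥ (0:ℝ), |β t| ≤ M)
    (hη : ContinuousOn η (Ici 0) ∧ (∀ t ≥ (0:ℝ), 0 ≤ η t) ∧ ∃ M, ∀ t ≥ (0:ℝ), |η t| ≤ M)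
    (hc : ContinuousOn c (Ici 0) ∧ (∀ t ≥ (0:ℝ), 0 ≤ c t) ∧ ∃ M, ∀ t ≥ (0:ℝ), |c t| ≤ M)
    (hθ : ContinuousOn θ (Ici 0) ∧ (∀ t ≥ (0:ℝ), 0 ≤ θ t) ∧ ∃ M, ∀ t ≥ (0:ℝ), |θ t| ≤ M)
    (hcl : 0 < sInf (c '' Ici 0))
    (sstar ystar : ℝ → ℝ)
    (hsstar : ∀ t ≥ (0:ℝ), HasDerivAt sstar (k t (sstar t) * sstar t) t)
    (hsstar0 : 0 < sstar 0)
    (hsstarbdd : ∃ M, ∀ t ≥ (0:ℝ), |sstar t| ≤ M)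
    (hsstaraway : ∃ m' > (0:ℝ), ∀ t ≥ (0:ℝ), m' ≤ sstar t)
    (hsstarattr : ∀ u : ℝ → ℝ, (∀ t ≥ (0:ℝ), HasDerivAt u (k t (u t) * u t) t) →
      0 < u 0 → Tendsto (fun t => sstar t - u t) atTop (nhds 0))
    (hystar : ∀ t ≥ (0:ℝ), HasDerivAt ystar ((b - r * ystar t) * ystar t) t)
    (hystar0 : 0 < ystar 0)
    (lam : ℝ) (hlam : 0 < lam)
    (hRu : limsup (fun t => ∫ s in t..(t + lam),
        (β s * sstar s - η s * ystar s - c s)) atTop < 0) :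
    ∀ t₀ ≥ (0:ℝ), ∀ S I P : ℝ → ℝ,
      (∀ t ≥ t₀, HasDerivAt S
        (k t (S t) * S t - a * S t * P t / (m + S t + I t) - β t * S t * I t) t) →
      (∀ t ≥ t₀, HasDerivAt I
        (β t * S t * I t - η t * P t * I t - c t * I t) t) →
      (∀ t ≥ t₀, HasDerivAt P
        ((b - r * P t) * P t + γ * a * S t * P t / (m + S t + I t)
          + θ t * η t * P t * I t) t) →
      0 < S t₀ → 0 < I t₀ → 0 < P t₀ →
      Tendsto I atTop (nhds 0) := by
  intro t₀ ht₀ S I P hS hI hP hS0 hI0 hP0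
  obtain ⟨hβc, hβ0, Mβ, hMβ⟩ := hβ
  obtain ⟨hηc, hη0, Mη, hMη⟩ := hη
  obtain ⟨hcc, hc0, -⟩ := hc
  obtain ⟨hθc, hθ0, -⟩ := hθ
  obtain ⟨M, hM⟩ := hsstarbdd
  obtain ⟨m', hm', hms⟩ := hsstaraway
  have hScont : ContinuousOn S (Ici t₀) := fun t ht => (hS t ht).continuousAt.continuousWithinAt
  have hIcont : ContinuousOn I (Ici t₀) := fun t ht => (hI t ht).continuousAt.continuousWithinAt
  have hPcont : ContinuousOn P (Ici t₀) := fun t ht => (hP t ht).continuousAt.continuousWithinAt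
  have hycont : ContinuousOn ystar (Ici 0) :=
    fun t ht => (hystar t ht).continuousAt.continuousWithinAt
  have hscont : ContinuousOn sstar (Ici 0) :=
    fun t ht => (hsstar t ht).continuousAt.continuousWithinAt
  have hsub : Ici t₀ ⊆ Ici (0:ℝ) := Ici_subset_Ici.2 ht₀
  have hAcont : ContinuousOn (fun t => β t * S t - η t * P t - c t) (Ici t₀) :=
    (((hβc.mono hsub).mul hScont).sub ((hηc.mono hsub).mul hPcont)).sub (hcc.mono hsub)
  have hIpos : ∀ t ≥ t₀, 0 < I t := by
    apply aux_pos_s14 I (fun t => β t * S t - η t * P t - c t) t₀ _ hI0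
    · exact fun τ hτ _ => hAcont.mono (fun t ht => ht.1)
    · intro t ht
      convert hI t ht using 1
      ring
  have hSpos : ∀ t ≥ t₀, 0 < S t := by
    apply aux_pos_s14 S (fun t => k t (S t) - a * P t / (m + S t + I t) - β t * I t) t₀ _ hS0
    · intro τ hτ hnn
      have hs : Icc t₀ τ ⊆ Ici t₀ := fun t ht => ht.1
      have h1 : ContinuousOn (fun t => k t (S t)) (Icc t₀ τ) :=
        hkcont.comp (f := fun t => (t, S t)) (continuousOn_id.prodMk (hScont.mono hs))
          (fun t ht => ⟨mem_univ _, hnn t ht⟩)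
      refine (h1.sub (ContinuousOn.div ?_ ?_ ?_)).sub
        ((hβc.mono (hs.trans hsub)).mul (hIcont.mono hs))
      · exact continuousOn_const.mul (hPcont.mono hs)
      · exact (continuousOn_const.add (hScont.mono hs)).add (hIcont.mono hs)
      · intro t ht
        have := hnn t ht
        have := hIpos t ht.1
        positivity
    · intro t ht
      convert hS t ht using 1
      ring
  have hPpos : ∀ t ≥ t₀, 0 < P t := by
    apply aux_pos_s14 P (fun t => (b - r * P t) + γ * a * S t / (m + S t + I t) + θ t * η t * I t)
      t₀ _ hP0
    · intro τ hτ _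
      have hs : Icc t₀ τ ⊆ Ici t₀ := fun t ht => ht.1
      refine ContinuousOn.add (ContinuousOn.add ?_ (ContinuousOn.div ?_ ?_ ?_)) ?_
      · exact continuousOn_const.sub (continuousOn_const.mul (hPcont.mono hs))
      · exact continuousOn_const.mul (hScont.mono hs)
      · exact (continuousOn_const.add (hScont.mono hs)).add (hIcont.mono hs)
      · intro t ht
        have := hSpos t ht.1
        have := hIpos t ht.1
        positivity
      · exact ((hθc.mono (hs.trans hsub)).mul (hηc.mono (hs.trans hsub))).mul (hIcont.mono hs)
    · intro t ht
      convert hP t ht using 1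
      ring
  have hypos : ∀ t ≥ 0, 0 < ystar t := by
    apply aux_pos_s14 ystar (fun t => b - r * ystar t) 0 hystar hystar0
    intro τ hτ _
    exact continuousOn_const.sub (continuousOn_const.mul (hycont.mono (fun t ht => ht.1)))
  have hspos : ∀ t ≥ 0, 0 < sstar t := fun t ht => lt_of_lt_of_le hm' (hms t ht)
  -- eventual bounds on ystar
  obtain ⟨t₁, ht₁, hyup⟩ : ∃ t₁ ≥ (0:ℝ), ∀ t ≥ t₁, ystar t ≤ 2 * b / r := by
    refine aux_evle ystar _ 0 (2 * b / r) (b * (2 * b / r)) (by positivity) hystar ?_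
    intro t ht h
    have h1 : 2 * b ≤ r * ystar t := by rwa [div_le_iff₀' hr] at h
    have h2 : 0 < 2 * b / r := by positivity
    nlinarith [mul_le_mul (show b ≤ r * ystar t - b by linarith) h h2.le (by linarith)]
  obtain ⟨t₂, ht₂, hylo⟩ : ∃ t₂ ≥ (0:ℝ), ∀ t ≥ t₂, - Real.log (ystar t) ≤ - Real.log (b / (2 * r)) := by
    refine aux_evle (fun t => - Real.log (ystar t)) (fun t => -(b - r * ystar t)) 0 _ (b / 2)
      (by positivity) ?_ ?_
    · intro t ht
      have h1 := ((hystar t ht).log (hypos t ht).ne').neg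
      refine h1.congr_deriv ?_
      have := (hypos t ht).ne'
      field_simp
    · intro t ht h
      have h1 : ystar t ≤ b / (2 * r) := by
        rw [← Real.log_le_log_iff (hypos t ht) (by positivity)]
        linarith
      have h2 : r * ystar t ≤ r * (b / (2 * r)) := by gcongr
      have h3 : r * (b / (2 * r)) = b / 2 := by field_simp
      linarith
  have hylo' : ∀ t ≥ t₂, b / (2 * r) ≤ ystar t := by
    intro t ht
    rw [← Real.log_le_log_iff (by positivity) (hypos t (ht₂.trans ht))]
    linarith [hylo t ht]
  -- threshold
  obtain ⟨α, hα, hev⟩ : ∃ α > 0, ∀ᶠ t in atTop, (∫ s in t..(t + lam),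
        (β s * sstar s - η s * ystar s - c s)) ≤ -α := by
    rw [limsup_eq] at hRu
    have hne : {x : ℝ | ∀ᶠ t in atTop, (∫ s in t..(t + lam),
        (β s * sstar s - η s * ystar s - c s)) ≤ x}.Nonempty := by
      by_contra hcon
      rw [not_nonempty_iff_eq_empty] at hcon
      rw [hcon, Real.sInf_empty] at hRu
      exact lt_irrefl _ hRu
    obtain ⟨x, hx, hx0⟩ := exists_lt_of_csInf_lt hne hRu
    exact ⟨-x, by linarith, by simpa using hx⟩
  obtain ⟨t₃, ht₃⟩ := eventually_atTop.1 hev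
  have hMβ0 : 0 ≤ Mβ := (abs_nonneg _).trans (hMβ 0 le_rfl)
  have hMη0 : 0 ≤ Mη := (abs_nonneg _).trans (hMη 0 le_rfl)
  have hM0 : 0 ≤ M := (abs_nonneg _).trans (hM 0 le_rfl)
  set D : ℝ := Mβ * M + Mη * (2 * b / r) + 1 with hD
  have hDpos : 0 < D := by positivity
  set ε : ℝ := α / (2 * lam * D) with hε
  have hεpos : 0 < ε := by positivity
  have hlogE : 0 < Real.log (1 + ε) := Real.log_pos (by linarith)
  have hkanti : ∀ t, StrictAnti (k t) := by
    intro t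
    apply strictAnti_of_deriv_neg
    intro x
    rw [(hkdiff t x).deriv]
    exact hkSneg t x
  -- S ≤ (1+ε) sstar eventually
  obtain ⟨δ, hδ, hkδ⟩ : ∃ δ > 0, ∀ t, ∀ x ∈ Icc m' M, k t ((1 + ε) * x) ≤ k t x - δ := by
    have hmM : m' ≤ M := (hms 0 le_rfl).trans ((le_abs_self _).trans (hM 0 le_rfl))
    have hc1 : ContinuousOn (fun p : ℝ × ℝ => k p.1 p.2 - k p.1 ((1 + ε) * p.2))
        (Icc 0 T ×ˢ Icc m' M) := by
      refine ContinuousOn.sub (hkcont.mono ?_) (hkcont.comp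
        (f := fun p : ℝ × ℝ => (p.1, (1 + ε) * p.2)) (by fun_prop) ?_)
      · exact fun p hp => ⟨mem_univ _, hm'.le.trans hp.2.1⟩
      · intro p hp
        have : 0 ≤ p.2 := hm'.le.trans hp.2.1
        exact ⟨mem_univ _, show (0:ℝ) ≤ (1 + ε) * p.2 by positivity⟩
    obtain ⟨p, hp, hmin⟩ := (isCompact_Icc.prod isCompact_Icc).exists_isMinOn
      ⟨(0, m'), ⟨le_rfl, hT.le⟩, ⟨le_rfl, hmM⟩⟩ hc1
    refine ⟨k p.1 p.2 - k p.1 ((1 + ε) * p.2), ?_, ?_⟩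
    · have h1 : 0 < p.2 := hm'.trans_le hp.2.1
      have := hkanti p.1 (show p.2 < (1 + ε) * p.2 by nlinarith)
      linarith
    · intro t x hx
      have hper : Function.Periodic k T := fun t => funext (hkper t)
      obtain ⟨y, hy, hky⟩ := hper.exists_mem_Ico₀ hT t
      rw [hky]
      have := hmin (show (y, x) ∈ Icc 0 T ×ˢ Icc m' M from ⟨⟨hy.1, hy.2.le⟩, hx⟩)
      simp only [mem_ofPred_eq] at this
      linarith
  obtain ⟨t₄, ht₄, hSle⟩ : ∃ t₄ ≥ t₀, ∀ t ≥ t₄,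
      Real.log (S t) - Real.log (sstar t) ≤ Real.log (1 + ε) := by
    refine aux_evle (fun t => Real.log (S t) - Real.log (sstar t))
      (fun t => (k t (S t) - a * P t / (m + S t + I t) - β t * I t) - k t (sstar t))
      t₀ _ δ hδ ?_ ?_
    · intro t ht
      have hs := hspos t (ht₀.trans ht)
      have h1 := ((hS t ht).log (hSpos t ht).ne').sub
        ((hsstar t (ht₀.trans ht)).log hs.ne')
      refine h1.congr_deriv ?_
      have := (hSpos t ht).ne'
      have := hs.ne'
      field_simp
    · intro t ht h
      have ht' : 0 ≤ t := ht₀.trans ht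
      have hs := hspos t ht'
      have h1 : (1 + ε) * sstar t ≤ S t := by
        rw [← Real.log_le_log_iff (by positivity) (hSpos t ht),
          Real.log_mul (by positivity) hs.ne']
        linarith
      have h2 := (hkanti t).antitone h1
      have h3 := hkδ t (sstar t) ⟨hms t ht', (le_abs_self _).trans (hM t ht')⟩
      have h4 : 0 ≤ a * P t / (m + S t + I t) := by
        have := hSpos t ht
        have := hIpos t ht
        have := hPpos t ht
        positivity
      have h5 : 0 ≤ β t * I t := mul_nonneg (hβ0 t ht') (hIpos t ht).le
      linarith
  have hSle' : ∀ t ≥ t₄, S t ≤ (1 + ε) * sstar t := by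
    intro t ht
    have hs := hspos t (ht₀.trans (ht₄.trans ht))
    rw [← Real.log_le_log_iff (hSpos t (ht₄.trans ht)) (by positivity),
          Real.log_mul (by positivity) hs.ne']
    linarith [hSle t ht]
  -- ystar ≤ (1+ε) P eventually
  obtain ⟨t₅, ht₅, hPle⟩ : ∃ t₅ ≥ max t₀ t₂, ∀ t ≥ t₅,
      Real.log (ystar t) - Real.log (P t) ≤ Real.log (1 + ε) := by
    refine aux_evle (fun t => Real.log (ystar t) - Real.log (P t))
      (fun t => (b - r * ystar t) -
        ((b - r * P t) + γ * a * S t / (m + S t + I t) + θ t * η t * I t))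
      (max t₀ t₂) _ (r * (ε / (1 + ε) * (b / (2 * r)))) (by positivity) ?_ ?_
    · intro t ht
      have ht' : t ≥ t₀ := (le_max_left _ _).trans ht
      have hy := hypos t (ht₀.trans ht')
      have h1 := ((hystar t (ht₀.trans ht')).log hy.ne').sub
        ((hP t ht').log (hPpos t ht').ne')
      refine h1.congr_deriv ?_
      have := (hPpos t ht').ne'
      have := hy.ne'
      field_simp
    · intro t ht h
      have ht' : t ≥ t₀ := (le_max_left _ _).trans ht
      have ht0 : 0 ≤ t := ht₀.trans ht'
      have hy := hypos t ht0
      have hp := hPpos t ht'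
      have hs := hSpos t ht'
      have hi := hIpos t ht'
      have h1 : (1 + ε) * P t ≤ ystar t := by
        rw [← Real.log_le_log_iff (by positivity) hy,
          Real.log_mul (by positivity) hp.ne']
        linarith
      have h2 : P t ≤ ystar t / (1 + ε) := by rwa [le_div_iff₀' (by positivity)]
      have h3 : ystar t - ystar t / (1 + ε) = ε / (1 + ε) * ystar t := by
        field_simp
        ring
      have h4 : ε / (1 + ε) * (b / (2 * r)) ≤ ε / (1 + ε) * ystar t :=
        mul_le_mul_of_nonneg_left (hylo' t ((le_max_right _ _).trans ht)) (by positivity)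
      have h5 : r * (ε / (1 + ε) * (b / (2 * r))) ≤ r * (ystar t - P t) :=
        mul_le_mul_of_nonneg_left (by linarith) hr.le
      have h6 : 0 ≤ γ * a * S t / (m + S t + I t) := by positivity
      have h7 : 0 ≤ θ t * η t * I t := mul_nonneg (mul_nonneg (hθ0 t ht0) (hη0 t ht0)) hi.le
      linarith
  have hPle' : ∀ t ≥ t₅, (1 - ε) * ystar t ≤ P t := by
    intro t ht
    have ht' : t ≥ t₀ := (le_max_left _ _).trans (ht₅.trans ht)
    have hy := hypos t (ht₀.trans ht')
    have hp := hPpos t ht'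
    have h1 : ystar t ≤ (1 + ε) * P t := by
      rw [← Real.log_le_log_iff hy (by positivity), Real.log_mul (by positivity) hp.ne']
      linarith [hPle t ht]
    rcases le_total 1 ε with h | h
    · nlinarith
    · have h2 := mul_le_mul_of_nonneg_left h1 (show 0 ≤ 1 - ε by linarith)
      have h3 : (1 - ε) * ((1 + ε) * P t) = P t - ε ^ 2 * P t := by ring
      have h4 : 0 ≤ ε ^ 2 * P t := by positivity
      linarith
  -- conclusion
  set t₆ := max (max t₁ t₃) (max t₄ t₅) with ht₆
  have h61 : t₁ ≤ t₆ := (le_max_left _ _).trans (le_max_left _ _)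
  have h63 : t₃ ≤ t₆ := (le_max_right _ _).trans (le_max_left _ _)
  have h64 : t₄ ≤ t₆ := (le_max_left _ _).trans (le_max_right _ _)
  have h65 : t₅ ≤ t₆ := (le_max_right _ _).trans (le_max_right _ _)
  have h60 : t₀ ≤ t₆ := le_trans ht₄ h64
  have hbound : ∀ t ≥ t₆, β t * S t - η t * P t - c t ≤
      (β t * sstar t - η t * ystar t - c t) + α / (2 * lam) := by
    intro t ht
    have ht0 : 0 ≤ t := ht₀.trans (h60.trans ht)
    have h1 := mul_le_mul_of_nonneg_left (hSle' t (h64.trans ht)) (hβ0 t ht0)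
    have h2 := mul_le_mul_of_nonneg_left (hPle' t (h65.trans ht)) (hη0 t ht0)
    have h3 : β t * sstar t ≤ Mβ * M := mul_le_mul ((le_abs_self _).trans (hMβ t ht0))
      ((le_abs_self _).trans (hM t ht0)) (hspos t ht0).le hMβ0
    have h4 : η t * ystar t ≤ Mη * (2 * b / r) := mul_le_mul ((le_abs_self _).trans (hMη t ht0))
      (hyup t (h61.trans ht)) (hypos t ht0).le hMη0
    have h5 : ε * (β t * sstar t + η t * ystar t) ≤ ε * D :=
      mul_le_mul_of_nonneg_left (by rw [hD]; linarith) hεpos.le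
    have h6 : ε * D = α / (2 * lam) := by
      rw [hε]
      field_simp
    linarith
  have hJ : Tendsto (fun t => Real.log (I t)) atTop atBot := by
    refine aux_tendsto _ t₆ lam (α / 2) hlam (by positivity) ?_ ?_
    · exact (hIcont.mono (Ici_subset_Ici.2 h60)).log (fun t ht => (hIpos t (h60.trans ht)).ne')
    · intro t ht
      have hle : t ≤ t + lam := by linarith
      have hu : uIcc t (t + lam) ⊆ Ici t₀ := by
        rw [uIcc_of_le hle]
        exact fun s hs => h60.trans (le_trans ht hs.1)
      have hAint : IntervalIntegrable (fun t => β t * S t - η t * P t - c t) volume t (t + lam) :=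
        (hAcont.mono hu).intervalIntegrable
      have hFint : IntervalIntegrable (fun s => β s * sstar s - η s * ystar s - c s)
          volume t (t + lam) :=
        ((((hβc.mul hscont).sub (hηc.mul hycont)).sub hcc).mono
          (hu.trans hsub)).intervalIntegrable
      have hftc : ∫ s in t..(t + lam), (β s * S s - η s * P s - c s)
          = Real.log (I (t + lam)) - Real.log (I t) := by
        refine intervalIntegral.integral_eq_sub_of_hasDerivAt (f := fun s => Real.log (I s)) ?_ hAint
        intro s hs
        have hs' := hu hs
        have h1 := (hI s hs').log (hIpos s hs').ne'
        refine h1.congr_deriv ?_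
        have := (hIpos s hs').ne'
        field_simp
      have hmono := intervalIntegral.integral_mono_on hle hAint
        (hFint.add (intervalIntegrable_const (c := α / (2 * lam))))
        (fun s hs => hbound s (le_trans ht hs.1))
      have hadd := intervalIntegral.integral_add hFint
        (intervalIntegrable_const (c := α / (2 * lam)) (μ := volume) (a := t) (b := t + lam))
      have h3 := ht₃ t (h63.trans ht)
      have h4 : ∫ s in t..(t + lam), α / (2 * lam) = α / 2 := by
        rw [intervalIntegral.integral_const]
        simp only [smul_eq_mul]
        field_simp
        ring
      rw [hftc] at hmono
      rw [h4] at hadd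
      have hadd' := hmono.trans hadd.le
      linarith
  have hfin := Real.tendsto_exp_atBot.comp hJ
  refine hfin.congr' ?_
  filter_upwards [eventually_ge_atTop t₀] with t ht
  exact Real.exp_log (hIpos t ht)
end

section
/- Let Λ, μ, a, m, b, r, γ be positive constants and β, η, c, θ : [0,∞) → ℝ bounded, nonnegative and continuous with inf c > 0. Let s* be a solution of s' = Λ − μs and y* a solution of y' = (b − ry)y, both with positive initial conditions. If there exists λ > 0 with limsup_{t→∞} ∫_t^{t+λ} [β(s)s*(s) − η(s)y*(s) − c(s)] ds < 0 (equivalently, since s*(t) → Λ/μ and y*(t) → b/r, limsup_{t→∞} ∫_t^{t+λ} [β(s)Λ/μ − η(s)b/r − c(s)] ds < 0), then for every solution (S,I,P), with positive initial conditions, of the ratio-dependent system S' = Λ − μS − aSP/(mP+S+I) − β(t)SI, I' = β(t)SI − η(t)PI − c(t)I, P' = (b − rP)P + γaSP/(mP+S+I) + θ(t)η(t)PI, one has I(t) → 0 as t → +∞. -/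
open Filter MeasureTheory Set

lemma first_time {F : ℝ → ℝ} {t₀ : ℝ} (hF : ContinuousOn F (Ici t₀))
    (h : ∀ T ≥ t₀, (∀ t, t₀ ≤ t → t < T → 0 < F t) → 0 < F T) : ∀ t ≥ t₀, 0 < F t := by
  intro t₁ ht₁
  by_contra hneg
  have hc : IsCompact (Icc t₀ t₁ ∩ F ⁻¹' (Iic 0)) := by
    apply isCompact_Icc.of_isClosed_subset _ inter_subset_left
    exact (hF.mono Icc_subset_Ici_self).preimage_isClosed_of_isClosed isClosed_Icc isClosed_Iic
  obtain ⟨T, hT, hmin⟩ := hc.exists_isLeast ⟨t₁, ⟨ht₁, le_rfl⟩, not_lt.1 hneg⟩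
  have := h T hT.1.1 (fun t h1 h2 => by
    by_contra h3
    exact absurd (hmin ⟨⟨h1, h2.le.trans hT.1.2⟩, not_lt.1 h3⟩) (not_le.2 h2))
  exact absurd hT.2 (not_le.2 this)

lemma pos_of_deriv {f f' : ℝ → ℝ} {t₀ T K : ℝ} (hT : t₀ ≤ T)
    (hf : ∀ t ≥ t₀, HasDerivAt f (f' t) t) (h : ∀ t, t₀ < t → t < T → -K * f t ≤ f' t)
    (h0 : 0 < f t₀) : 0 < f T := by
  have hd : ∀ t ≥ t₀, HasDerivAt (fun t => f t * Real.exp (K * t))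
      (f' t * Real.exp (K * t) + f t * (Real.exp (K * t) * (K * 1))) t := fun t ht =>
    (hf t ht).mul (((hasDerivAt_id t).const_mul K).exp)
  have hm : MonotoneOn (fun t => f t * Real.exp (K * t)) (Icc t₀ T) := by
    apply monotoneOn_of_deriv_nonneg (convex_Icc _ _)
    · exact fun t ht => (hd t ht.1).continuousAt.continuousWithinAt
    · intro t ht
      rw [interior_Icc] at ht
      exact (hd t ht.1.le).differentiableAt.differentiableWithinAt
    · intro t ht
      rw [interior_Icc] at ht
      rw [(hd t ht.1.le).deriv]
      have := h t ht.1 ht.2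
      have e := Real.exp_pos (K * t)
      nlinarith [mul_nonneg e.le (sub_nonneg.2 this)]
  have := hm ⟨le_rfl, hT⟩ ⟨hT, le_rfl⟩ hT
  have h2 : 0 < f T * Real.exp (K * T) := lt_of_lt_of_le (mul_pos h0 (Real.exp_pos _)) this
  exact pos_of_mul_pos_left h2 (Real.exp_pos _).le

lemma decay {f f' : ℝ → ℝ} {t₀ A B : ℝ} (hB : 0 < B)
    (hf : ∀ t ≥ t₀, HasDerivAt f (f' t) t) (h : ∀ t ≥ t₀, f' t ≤ A - B * f t)
    {ε : ℝ} (hε : 0 < ε) : ∀ᶠ t in atTop, f t ≤ A / B + ε := by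
  have hd : ∀ t ≥ t₀, HasDerivAt (fun t => (f t - A / B) * Real.exp (B * t))
      (f' t * Real.exp (B * t) + (f t - A / B) * (Real.exp (B * t) * (B * 1))) t := fun t ht =>
    ((hf t ht).sub_const _).mul (((hasDerivAt_id t).const_mul B).exp)
  have hm : AntitoneOn (fun t => (f t - A / B) * Real.exp (B * t)) (Ici t₀) := by
    apply antitoneOn_of_deriv_nonpos (convex_Ici _)
    · exact fun t ht => (hd t ht).continuousAt.continuousWithinAt
    · intro t ht
      rw [interior_Ici] at ht
      exact (hd t (le_of_lt ht)).differentiableAt.differentiableWithinAt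
    · intro t ht
      rw [interior_Ici] at ht
      rw [(hd t (le_of_lt ht)).deriv]
      have h1 := h t (le_of_lt ht)
      have e := Real.exp_pos (B * t)
      have h2 : (f t - A / B) * (Real.exp (B * t) * (B * 1)) =
        (B * f t - A) * Real.exp (B * t) := by field_simp
      rw [h2]
      nlinarith [mul_nonneg e.le (sub_nonneg.2 h1)]
  set C := (f t₀ - A / B) * Real.exp (B * t₀)
  have ht : Tendsto (fun t => ε * Real.exp (B * t)) atTop atTop :=
    (Real.tendsto_exp_atTop.comp (tendsto_id.const_mul_atTop hB)).const_mul_atTop hε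
  filter_upwards [ht.eventually_ge_atTop C, eventually_ge_atTop t₀] with t h1 h2
  have h3 : (f t - A / B) * Real.exp (B * t) ≤ C := hm self_mem_Ici h2 h2
  have := le_of_mul_le_mul_right (h3.trans h1) (Real.exp_pos _)
  linarith

lemma geom_tendsto {f : ℝ → ℝ} {T q lam : ℝ} (hlam : 0 < lam) (hq0 : 0 ≤ q) (hq : q < 1)
    (hc : ContinuousOn f (Ici T)) (hp : ∀ t ≥ T, 0 ≤ f t)
    (h : ∀ t ≥ T, f (t + lam) ≤ q * f t) : Tendsto f atTop (nhds 0) := by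
  obtain ⟨B, hB⟩ := (isCompact_Icc (a := T) (b := T + lam)).bddAbove_image
    (hc.mono Icc_subset_Ici_self)
  have key : ∀ n : ℕ, ∀ t, T ≤ t → t ≤ T + lam → f (t + n * lam) ≤ q ^ n * B := by
    intro n t h1 h2
    induction n with
    | zero => simpa using hB (mem_image_of_mem f ⟨h1, h2⟩)
    | succ k ih =>
      have e : t + ((k + 1 : ℕ) : ℝ) * lam = (t + k * lam) + lam := by push_cast; ring
      rw [e, pow_succ']
      refine (h _ ?_).trans ?_
      · have : 0 ≤ (k : ℝ) * lam := by positivity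
        show T ≤ _
        linarith
      · rw [mul_assoc]
        exact mul_le_mul_of_nonneg_left ih hq0
  have hfl : Tendsto (fun t : ℝ => ⌊(t - T) / lam⌋₊) atTop atTop := by
    apply tendsto_nat_floor_atTop.comp
    apply Tendsto.atTop_div_const hlam
    exact tendsto_atTop_add_const_right _ _ tendsto_id
  have hlim : Tendsto (fun t : ℝ => q ^ ⌊(t - T) / lam⌋₊ * B) atTop (nhds 0) := by
    have := ((tendsto_pow_atTop_nhds_zero_of_lt_one hq0 hq).comp hfl).mul_const B
    simpa using this
  refine tendsto_of_tendsto_of_tendsto_of_le_of_le' tendsto_const_nhds hlim ?_ ?_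
  · filter_upwards [eventually_ge_atTop T] with t ht using hp t ht
  · filter_upwards [eventually_ge_atTop T] with t ht
    set n := ⌊(t - T) / lam⌋₊
    have h1 : (n : ℝ) ≤ (t - T) / lam := Nat.floor_le (div_nonneg (by linarith) hlam.le)
    have h2 : (t - T) / lam < n + 1 := Nat.lt_floor_add_one _
    rw [le_div_iff₀ hlam] at h1
    rw [div_lt_iff₀ hlam] at h2
    have := key n (t - n * lam) (by linarith) (by linarith)
    simpa using this

lemma positivity_all
    {Λ μ a m b r γ : ℝ}
    (hΛ : 0 < Λ) (ha : 0 < a) (hm : 0 < m) (hb : 0 < b) (hr : 0 < r)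
    (hγ : 0 < γ) {β η c θ : ℝ → ℝ} {t₀ Mβ Mη Mc : ℝ} 
    (hβ0 : ∀ t ≥ t₀, 0 ≤ β t) (hβM : ∀ t ≥ t₀, β t ≤ Mβ)
    (hη0 : ∀ t ≥ t₀, 0 ≤ η t) (hηM : ∀ t ≥ t₀, η t ≤ Mη)
    (hcM : ∀ t ≥ t₀, c t ≤ Mc) (hθ0 : ∀ t ≥ t₀, 0 ≤ θ t)
    {S I P : ℝ → ℝ}
    (hS : ∀ t ≥ t₀, HasDerivAt S
        (Λ - μ * S t - a * S t * P t / (m * P t + S t + I t) - β t * S t * I t) t)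
    (hI : ∀ t ≥ t₀, HasDerivAt I
        (β t * S t * I t - η t * P t * I t - c t * I t) t)
    (hP : ∀ t ≥ t₀, HasDerivAt P
        ((b - r * P t) * P t + γ * a * S t * P t / (m * P t + S t + I t)
          + θ t * η t * P t * I t) t)
    (hS0 : 0 < S t₀) (hI0 : 0 < I t₀) (hP0 : 0 < P t₀) :
    ∀ t ≥ t₀, 0 < S t ∧ 0 < I t ∧ 0 < P t := by
  have cS : ContinuousOn S (Ici t₀) := fun t ht => (hS t ht).continuousAt.continuousWithinAt
  have cI : ContinuousOn I (Ici t₀) := fun t ht => (hI t ht).continuousAt.continuousWithinAt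
  have cP : ContinuousOn P (Ici t₀) := fun t ht => (hP t ht).continuousAt.continuousWithinAt
  have := first_time (F := fun t => min (S t) (min (I t) (P t))) (t₀ := t₀)
    (ContinuousOn.inf cS (ContinuousOn.inf cI cP)) ?_
  · intro t ht
    simpa [lt_min_iff] using this t ht
  intro T hT hpos
  simp only [lt_min_iff] at hpos ⊢
  obtain ⟨BI, hBI⟩ := (isCompact_Icc (a := t₀) (b := T)).bddAbove_image
    (cI.mono Icc_subset_Ici_self)
  obtain ⟨BP, hBP⟩ := (isCompact_Icc (a := t₀) (b := T)).bddAbove_image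
    (cP.mono Icc_subset_Ici_self)
  have bI : ∀ t, t₀ < t → t < T → I t ≤ BI := fun t h1 h2 =>
    hBI (mem_image_of_mem I ⟨h1.le, h2.le⟩)
  have bP : ∀ t, t₀ < t → t < T → P t ≤ BP := fun t h1 h2 =>
    hBP (mem_image_of_mem P ⟨h1.le, h2.le⟩)
  refine ⟨pos_of_deriv (K := μ + a / m + Mβ * BI) hT hS ?_ hS0,
    pos_of_deriv (K := Mη * BP + Mc) hT hI ?_ hI0, pos_of_deriv (K := r * BP) hT hP ?_ hP0⟩
  · intro t h1 h2
    obtain ⟨p1, p2, p3⟩ := hpos t h1.le h2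
    have hD : 0 < m * P t + S t + I t := by positivity
    have e1 : a * S t * P t / (m * P t + S t + I t) ≤ a / m * S t := by
      rw [div_le_iff₀ hD]
      have : a / m * S t * (m * P t + S t + I t) =
        a * S t * P t + a / m * S t * (S t + I t) := by field_simp; ring
      rw [this]
      have : 0 < a / m * S t * (S t + I t) := by positivity
      linarith
    have e2 : β t * I t ≤ Mβ * BI :=
      mul_le_mul (hβM t h1.le) (bI t h1 h2) p2.le ((hβ0 t h1.le).trans (hβM t h1.le))
    nlinarith [mul_le_mul_of_nonneg_right e2 p1.le]
  · intro t h1 h2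
    obtain ⟨p1, p2, p3⟩ := hpos t h1.le h2
    have e2 : η t * P t ≤ Mη * BP :=
      mul_le_mul (hηM t h1.le) (bP t h1 h2) p3.le ((hη0 t h1.le).trans (hηM t h1.le))
    have e3 := mul_le_mul_of_nonneg_right e2 p2.le
    have e4 := mul_le_mul_of_nonneg_right (hcM t h1.le) p2.le
    have e5 : 0 ≤ β t * S t * I t := mul_nonneg (mul_nonneg (hβ0 t h1.le) p1.le) p2.le
    nlinarith
  · intro t h1 h2
    obtain ⟨p1, p2, p3⟩ := hpos t h1.le h2
    have e1 : 0 < γ * a * S t * P t / (m * P t + S t + I t) := by positivity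
    have e2 : 0 ≤ θ t * η t * P t * I t :=
      mul_nonneg (mul_nonneg (mul_nonneg (hθ0 t h1.le) (hη0 t h1.le)) p3.le) p2.le
    have e3 := mul_le_mul_of_nonneg_right (bP t h1 h2) p3.le
    have e4 := mul_le_mul_of_nonneg_left e3 hr.le
    nlinarith [mul_pos hb p3]

lemma logistic_pos {b r : ℝ} (hb : 0 < b) (hr : 0 < r) {y : ℝ → ℝ}
    (hy : ∀ t ≥ (0:ℝ), HasDerivAt y ((b - r * y t) * y t) t) (hy0 : 0 < y 0) :
    ∀ t ≥ (0:ℝ), 0 < y t := by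
  have cy : ContinuousOn y (Ici 0) := fun t ht => (hy t ht).continuousAt.continuousWithinAt
  apply first_time cy
  intro T hT hpos
  obtain ⟨BP, hBP⟩ := (isCompact_Icc (a := 0) (b := T)).bddAbove_image
    (cy.mono Icc_subset_Ici_self)
  refine pos_of_deriv (K := r * BP) hT hy ?_ hy0
  intro t h1 h2
  have p := hpos t h1.le h2
  have e3 := mul_le_mul_of_nonneg_right (hBP (mem_image_of_mem y ⟨h1.le, h2.le⟩)) p.le
  have e4 := mul_le_mul_of_nonneg_left e3 hr.le
  nlinarith [mul_pos hb p]

/-- STATEMENT 16: extinction for the eco-epidemiological model whose uninfected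
subsystem is ratio-dependent: `G(t,S) = Λ − μS`, `f(S,I,P) = S/(mP+S+I)`,
`g(S,I,P) = P` and `h(t,P) = b − rP`. -/
theorem stmt_16
    (Λ μ a m b r γ : ℝ)
    (hΛ : 0 < Λ) (hμ : 0 < μ) (ha : 0 < a) (hm : 0 < m) (hb : 0 < b) (hr : 0 < r)
    (hγ : 0 < γ)
    (β η c θ : ℝ → ℝ)
    (hβ : ContinuousOn β (Ici 0) ∧ (∀ t ≥ (0:ℝ), 0 ≤ β t) ∧ ∃ M, ∀ t ≥ (0:ℝ), |β t| ≤ M)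
    (hη : ContinuousOn η (Ici 0) ∧ (∀ t ≥ (0:ℝ), 0 ≤ η t) ∧ ∃ M, ∀ t ≥ (0:ℝ), |η t| ≤ M)
    (hc : ContinuousOn c (Ici 0) ∧ (∀ t ≥ (0:ℝ), 0 ≤ c t) ∧ ∃ M, ∀ t ≥ (0:ℝ), |c t| ≤ M)
    (hθ : ContinuousOn θ (Ici 0) ∧ (∀ t ≥ (0:ℝ), 0 ≤ θ t) ∧ ∃ M, ∀ t ≥ (0:ℝ), |θ t| ≤ M)
    (hcl : 0 < sInf (c '' Ici 0))
    (sstar ystar : ℝ → ℝ)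
    (hsstar : ∀ t ≥ (0:ℝ), HasDerivAt sstar (Λ - μ * sstar t) t)
    (hsstar0 : 0 < sstar 0)
    (hystar : ∀ t ≥ (0:ℝ), HasDerivAt ystar ((b - r * ystar t) * ystar t) t)
    (hystar0 : 0 < ystar 0)
    (lam : ℝ) (hlam : 0 < lam)
    (hRu : limsup (fun t => ∫ s in t..(t + lam),
        (β s * sstar s - η s * ystar s - c s)) atTop < 0) :
    ∀ t₀ ≥ (0:ℝ), ∀ S I P : ℝ → ℝ,
      (∀ t ≥ t₀, HasDerivAt S
        (Λ - μ * S t - a * S t * P t / (m * P t + S t + I t) - β t * S t * I t) t) →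
      (∀ t ≥ t₀, HasDerivAt I
        (β t * S t * I t - η t * P t * I t - c t * I t) t) →
      (∀ t ≥ t₀, HasDerivAt P
        ((b - r * P t) * P t + γ * a * S t * P t / (m * P t + S t + I t)
          + θ t * η t * P t * I t) t) →
      0 < S t₀ → 0 < I t₀ → 0 < P t₀ →
      Tendsto I atTop (nhds 0) := by
  obtain ⟨cβ, hβ0, Mβ, hMβ⟩ := hβ
  obtain ⟨cη, hη0, Mη, hMη⟩ := hη
  obtain ⟨cc, hc0, Mc, hMc⟩ := hc
  obtain ⟨-, hθ0, -⟩ := hθ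
  intro t₀ ht₀ S I P hS hI hP hS0 hI0 hP0
  have hβM : ∀ t ≥ (0:ℝ), β t ≤ Mβ := fun t ht => (le_abs_self _).trans (hMβ t ht)
  have hηM : ∀ t ≥ (0:ℝ), η t ≤ Mη := fun t ht => (le_abs_self _).trans (hMη t ht)
  have hcM : ∀ t ≥ (0:ℝ), c t ≤ Mc := fun t ht => (le_abs_self _).trans (hMc t ht)
  have hMβ0 : 0 ≤ Mβ := (hβ0 0 le_rfl).trans (hβM 0 le_rfl)
  have hMη0 : 0 ≤ Mη := (hη0 0 le_rfl).trans (hηM 0 le_rfl)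
  have up : ∀ t, t ≥ t₀ → t ≥ (0:ℝ) := fun t ht => ht₀.le.trans ht
  have pos := positivity_all hΛ ha hm hb hr hγ (fun t ht => hβ0 t (up t ht))
    (fun t ht => hβM t (up t ht)) (fun t ht => hη0 t (up t ht)) (fun t ht => hηM t (up t ht))
    (fun t ht => hcM t (up t ht)) (fun t ht => hθ0 t (up t ht)) hS hI hP hS0 hI0 hP0
  have ypos := logistic_pos hb hr hystar hystar0
  have cs : ContinuousOn sstar (Ici 0) :=
    fun t ht => (hsstar t ht).continuousAt.continuousWithinAt
  have cy : ContinuousOn ystar (Ici 0) :=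
    fun t ht => (hystar t ht).continuousAt.continuousWithinAt
  -- bounds on the reference solutions
  have sB : ∀ᶠ t in atTop, sstar t ≤ Λ / μ + 1 :=
    decay hμ hsstar (fun t _ => le_rfl) one_pos
  have dyi : ∀ t ≥ (0:ℝ), HasDerivAt (fun t => (ystar t)⁻¹) (r - b * (ystar t)⁻¹) t := by
    intro t ht
    have hy := ypos t ht
    refine ((hystar t ht).inv hy.ne').congr_deriv ?_
    field_simp
    ring
  have yB : ∀ᶠ t in atTop, ystar t ≤ 2 * b / r := by
    have := decay (f := fun t => -(ystar t)⁻¹) (A := -r) hb (fun t ht => (dyi t ht).neg)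
      (fun t _ => by linarith) (ε := r / (2 * b)) (by positivity)
    filter_upwards [this, eventually_ge_atTop 0] with t h1 h2
    have hy := ypos t h2
    have h3 : r / (2 * b) ≤ (ystar t)⁻¹ := by
      have : -r / b + r / (2 * b) = - (r / (2 * b)) := by field_simp; ring
      linarith
    have h4 := inv_anti₀ (by positivity) h3
    rwa [inv_inv, inv_div] at h4
  -- comparison
  have hSs : ∀ ε > 0, ∀ᶠ t in atTop, S t ≤ sstar t + ε := by
    intro ε hε
    have := decay (f := fun t => S t - sstar t) (A := 0) hμ
      (fun t ht => (hS t ht).sub (hsstar t (up t ht))) (fun t ht => by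
        obtain ⟨p1, p2, p3⟩ := pos t ht
        have e1 : 0 < a * S t * P t / (m * P t + S t + I t) := by positivity
        have e2 : 0 ≤ β t * S t * I t := mul_nonneg (mul_nonneg (hβ0 t (up t ht)) p1.le) p2.le
        linarith) hε
    filter_upwards [this] with t ht
    rw [zero_div] at ht
    linarith
  have hPy : ∀ ε > 0, ∀ᶠ t in atTop, ystar t - ε ≤ P t := by
    intro ε hε
    have := decay (f := fun t => (P t)⁻¹ - (ystar t)⁻¹) (A := 0) hb
      (fun t ht => ((hP t ht).inv (pos t ht).2.2.ne').sub (dyi t (up t ht))) (fun t ht => by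
        obtain ⟨p1, p2, p3⟩ := pos t ht
        have e1 : 0 < γ * a * S t * P t / (m * P t + S t + I t) := by positivity
        have e2 : 0 ≤ θ t * η t * P t * I t :=
          mul_nonneg (mul_nonneg (mul_nonneg (hθ0 t (up t ht)) (hη0 t (up t ht))) p3.le) p2.le
        have e3 : -((b - r * P t) * P t + γ * a * S t * P t / (m * P t + S t + I t)
          + θ t * η t * P t * I t) / P t ^ 2 ≤ r - b * (P t)⁻¹ := by
          rw [div_le_iff₀ (by positivity)]
          have : (r - b * (P t)⁻¹) * P t ^ 2 = - ((b - r * P t) * P t) := by field_simp; ring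
          rw [this]
          linarith
        linarith) (ε := ε / (2 * b / r) ^ 2) (by positivity)
    filter_upwards [this, yB, eventually_ge_atTop t₀] with t h1 h2 h3
    obtain ⟨p1, p2, p3⟩ := pos t h3
    have hy := ypos t (up t h3)
    rw [zero_div, zero_add] at h1
    by_contra h4
    push Not at h4
    have h5 : (P t)⁻¹ - (ystar t)⁻¹ = (ystar t - P t) / (P t * ystar t) := by field_simp
    have h6 : P t * ystar t ≤ (2 * b / r) ^ 2 := by
      rw [sq]
      exact mul_le_mul (by linarith) h2 hy.le (by positivity)
    have h7 : ε / (2 * b / r) ^ 2 ≤ ε / (P t * ystar t) :=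
      div_le_div_of_nonneg_left hε.le (by positivity) h6
    have h8 : ε / (P t * ystar t) < (ystar t - P t) / (P t * ystar t) :=
      div_lt_div_of_pos_right (by linarith) (by positivity)
    linarith
  -- the threshold
  have cφ : ContinuousOn (fun s => β s * sstar s - η s * ystar s - c s) (Ici 0) :=
    ((cβ.mul cs).sub (cη.mul cy)).sub cc
  have iφ : ∀ t ≥ (0:ℝ), IntervalIntegrable
      (fun s => β s * sstar s - η s * ystar s - c s) volume t (t + lam) := fun t ht => by
    apply ContinuousOn.intervalIntegrable
    rw [uIcc_of_le (by linarith)]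
    exact cφ.mono (fun x hx => ht.le.trans hx.1)
  have hbdd : IsBoundedUnder (· ≤ ·) atTop (fun t => ∫ s in t..(t + lam),
        (β s * sstar s - η s * ystar s - c s)) := by
    obtain ⟨T, hT⟩ := eventually_atTop.1 sB
    refine ⟨lam * (Mβ * (Λ / μ + 1)), ?_⟩
    rw [eventually_map]
    filter_upwards [eventually_ge_atTop T, eventually_ge_atTop 0] with t h1 h2
    have : ∫ s in t..(t + lam), (β s * sstar s - η s * ystar s - c s) ≤
        ∫ _ in t..(t + lam), Mβ * (Λ / μ + 1) := by
      apply intervalIntegral.integral_mono_on (by linarith) (iφ t h2) (by simp)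
      intro s hs
      have hs0 : s ≥ 0 := h2.trans hs.1
      have e1 : β s * sstar s ≤ β s * (Λ / μ + 1) :=
        mul_le_mul_of_nonneg_left (hT s (h1.trans hs.1)) (hβ0 s hs0)
      have e2 : β s * (Λ / μ + 1) ≤ Mβ * (Λ / μ + 1) :=
        mul_le_mul_of_nonneg_right (hβM s hs0) (by positivity)
      have e3 := mul_nonneg (hη0 s hs0) (ypos s hs0).le
      have e4 := hc0 s hs0
      linarith
    rwa [intervalIntegral.integral_const, smul_eq_mul, add_sub_cancel_left] at this
  obtain ⟨δ, hδ1, hδ2⟩ := exists_between hRu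
  have hev := eventually_lt_of_limsup_lt hδ1 hbdd
  set ε : ℝ := -δ / (2 * lam * (Mβ + Mη + 1)) with hεd
  have hε : 0 < ε := div_pos (by linarith) (by positivity)
  have hεl : lam * (ε * (Mβ + Mη)) ≤ -δ / 2 := by
    have : -δ / 2 = lam * (ε * (Mβ + Mη + 1)) := by rw [hεd]; field_simp
    rw [this]
    exact mul_le_mul_of_nonneg_left (mul_le_mul_of_nonneg_left (by linarith) hε.le) hlam.le
  obtain ⟨T, hT⟩ := eventually_atTop.1
    (((hSs ε hε).and (hPy ε hε)).and (hev.and (eventually_ge_atTop t₀)))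
  have hTt : ∀ t ≥ T, t ≥ t₀ := fun t ht => (hT t ht).2.2
  refine geom_tendsto (T := T) (q := Real.exp (δ / 2)) hlam (Real.exp_pos _).le
    (by rw [← Real.exp_zero]; exact Real.exp_lt_exp.2 (by linarith))
    (fun t ht => (hI t (hTt t ht)).continuousAt.continuousWithinAt)
    (fun t ht => (pos t (hTt t ht)).2.1.le) ?_
  intro t ht
  have ht0 := up t (hTt t ht)
  have dL : ∀ s ≥ t, HasDerivAt (fun s => Real.log (I s)) (β s * S s - η s * P s - c s) s := by
    intro s hs
    have hs' := hTt s (ht.le.trans hs)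
    have hp := (pos s hs').2.1
    refine ((hI s hs').log hp.ne').congr_deriv ?_
    field_simp
  have hint : IntervalIntegrable (fun s => (β s * sstar s - η s * ystar s - c s)
      + ε * (Mβ + Mη)) volume t (t + lam) := (iφ t ht0).add (by simp)
  have key := intervalIntegral.sub_le_integral_of_hasDeriv_right_of_le (a := t) (b := t + lam)
    (g := fun s => Real.log (I s)) (g' := fun s => β s * S s - η s * P s - c s)
    (φ := fun s => (β s * sstar s - η s * ystar s - c s) + ε * (Mβ + Mη))
    (by linarith) (fun s hs => (dL s hs.1).continuousAt.continuousWithinAt)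
    (fun s hs => (dL s hs.1.le).hasDerivWithinAt)
    ((intervalIntegrable_iff_integrableOn_Icc_of_le (by linarith)).1 hint)
    (fun s hs => by
      have hsT : T ≤ s := ht.le.trans hs.1.le
      have hs0 : s ≥ 0 := ht0.le.trans hs.1.le
      obtain ⟨⟨h1, h2⟩, -⟩ := hT s hsT
      have e1 := mul_le_mul_of_nonneg_left h1 (hβ0 s hs0)
      have e2 := mul_le_mul_of_nonneg_left h2 (hη0 s hs0)
      have e3 := mul_le_mul_of_nonneg_right (hβM s hs0) hε.le
      have e4 := mul_le_mul_of_nonneg_right (hηM s hs0) hε.le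
      linarith)
  rw [intervalIntegral.integral_add (iφ t ht0) (by simp)] at key
  simp only [intervalIntegral.integral_const, smul_eq_mul, add_sub_cancel_left] at key
  have h9 := (hT t ht).2.1
  have hp1 := (pos t (hTt t ht)).2.1
  have hp2 := (pos (t + lam) (hTt _ (by linarith [show T ≤ t from ht]))).2.1
  rw [← Real.exp_log hp2]
  rw [← Real.exp_log hp1]
  rw [← Real.exp_add]
  apply Real.exp_le_exp.2
  linarith
end
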